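/- arXiv:1402.6563 — 4 statements merged into one kernel-verified Lean document; each statement's English description precedes it below -/
import Mathlib

section
/- (Nash inequality in ℝ × 𝕋) There exists a constant C > 0 such that for every continuously differentiable function f : Ω → ℝ with f ∈ L¹(Ω) ∩ L²(Ω) and ∇f ∈ L²(Ω), one has ‖f‖_{L²(Ω)} ≤ C · max{ ‖∇f‖_{L²(Ω)}^{1/3} ‖f‖_{L¹(Ω)}^{2/3} , ‖∇f‖_{L²(Ω)}^{1/2} ‖f‖_{L¹(Ω)}^{1/2} }. -/
noncomputable section

open MeasureTheory Real

namespace NS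

/-- The measure on the cylinder `Ω = ℝ × 𝕋`, identified with `ℝ × [0,1)`. -/
def μΩ : Measure (ℝ × ℝ) := volume.restrict (Set.univ ×ˢ Set.Ico (0:ℝ) 1)

/-- First partial derivative of a function on `ℝ²`. -/
def pd1 (g : ℝ × ℝ → ℝ) (x : ℝ × ℝ) : ℝ := deriv (fun y => g (y, x.2)) x.1

/-- Second partial derivative of a function on `ℝ²`. -/
def pd2 (g : ℝ × ℝ → ℝ) (x : ℝ × ℝ) : ℝ := deriv (fun y => g (x.1, y)) x.2

/-- A function on the cylinder: `1`-periodic in the second variable. -/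
def Periodic2 (g : ℝ × ℝ → ℝ) : Prop := ∀ x : ℝ × ℝ, g (x.1, x.2 + 1) = g x

/-- `L¹` norm on the cylinder. -/
def L1norm (f : ℝ × ℝ → ℝ) : ℝ := ∫ x, |f x| ∂μΩ

/-- `L²` norm on the cylinder. -/
def L2norm (f : ℝ × ℝ → ℝ) : ℝ := Real.sqrt (∫ x, f x ^ 2 ∂μΩ)

/-- `L²` norm of the gradient on the cylinder. -/
def GradL2norm (f : ℝ × ℝ → ℝ) : ℝ := Real.sqrt (∫ x, (pd1 f x ^ 2 + pd2 f x ^ 2) ∂μΩ)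

theorem hasDerivAt_pd1 {f : ℝ × ℝ → ℝ} (hf : ContDiff ℝ 1 f) (x : ℝ × ℝ) :
    HasDerivAt (fun y => f (y, x.2)) (fderiv ℝ f x (1, 0)) x.1 :=
  ((hf.differentiable one_ne_zero) (x.1, x.2)).hasFDerivAt.comp_hasDerivAt x.1
    ((hasDerivAt_id x.1).prodMk (hasDerivAt_const x.1 x.2))

theorem hasDerivAt_pd2 {f : ℝ × ℝ → ℝ} (hf : ContDiff ℝ 1 f) (x : ℝ × ℝ) :
    HasDerivAt (fun y => f (x.1, y)) (fderiv ℝ f x (0, 1)) x.2 :=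
  ((hf.differentiable one_ne_zero) (x.1, x.2)).hasFDerivAt.comp_hasDerivAt x.2
    ((hasDerivAt_const x.2 x.1).prodMk (hasDerivAt_id x.2))

theorem pd1_eq_fderiv {f : ℝ × ℝ → ℝ} (hf : ContDiff ℝ 1 f) :
    pd1 f = fun x => fderiv ℝ f x (1, 0) :=
  funext fun x => (hasDerivAt_pd1 hf x).deriv

theorem pd2_eq_fderiv {f : ℝ × ℝ → ℝ} (hf : ContDiff ℝ 1 f) :
    pd2 f = fun x => fderiv ℝ f x (0, 1) :=
  funext fun x => (hasDerivAt_pd2 hf x).deriv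

theorem continuous_pd1 {f : ℝ × ℝ → ℝ} (hf : ContDiff ℝ 1 f) : Continuous (pd1 f) := by
  rw [pd1_eq_fderiv hf]
  exact (hf.continuous_fderiv one_ne_zero).clm_apply continuous_const

theorem continuous_pd2 {f : ℝ × ℝ → ℝ} (hf : ContDiff ℝ 1 f) : Continuous (pd2 f) := by
  rw [pd2_eq_fderiv hf]
  exact (hf.continuous_fderiv one_ne_zero).clm_apply continuous_const

theorem μΩ_eq_prod :
    μΩ = (volume : Measure ℝ).prod (volume.restrict (Set.Ico (0:ℝ) 1)) := by
  rw [μΩ, Measure.volume_eq_prod, ← Measure.prod_restrict, Measure.restrict_univ]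

/-- An integrable `C¹` function on the line is bounded by the `L¹` norm of its derivative. -/
theorem enorm_le_lintegral_deriv {g g' : ℝ → ℝ} (hg : ∀ x, HasDerivAt g (g' x) x)
    (hc : Continuous g') (hi : Integrable g) (y : ℝ) :
    ‖g y‖ₑ ≤ ∫⁻ s, ‖g' s‖ₑ := by
  by_cases hfin : ∫⁻ s, ‖g' s‖ₑ = ⊤
  · simp [hfin]
  have hi' : Integrable g' := ⟨hc.aestronglyMeasurable, lt_top_iff_ne_top.2 hfin⟩
  have h0 : Filter.Tendsto g Filter.atBot (nhds 0) :=
    tendsto_zero_of_hasDerivAt_of_integrableOn_Iic (a := y) (fun x _ => hg x)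
      hi'.integrableOn hi.integrableOn
  have h := integral_Iic_of_hasDerivAt_of_tendsto' (a := y) (fun x _ => hg x)
    hi'.integrableOn h0
  rw [sub_zero] at h
  rw [← h]
  exact (enorm_integral_le_lintegral_enorm _).trans (setLIntegral_le_lintegral _ _)

/-- A `C¹` function on the unit interval is bounded by its `W^{1,1}` norm. -/
theorem enorm_le_lintegral_Ico_add_deriv {g g' : ℝ → ℝ} (hg : ∀ x, HasDerivAt g (g' x) x)
    (hc : Continuous g') {y : ℝ} (hy : y ∈ Set.Ico (0:ℝ) 1) :
    ‖g y‖ₑ ≤ (∫⁻ t in Set.Ico (0:ℝ) 1, ‖g t‖ₑ) + ∫⁻ t in Set.Ico (0:ℝ) 1, ‖g' t‖ₑ := by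
  have hgc : Continuous g := continuous_iff_continuousAt.2 fun x => (hg x).continuousAt
  set D := ∫⁻ t in Set.Ico (0:ℝ) 1, ‖g' t‖ₑ with hD
  have key : ∀ t ∈ Set.Ico (0:ℝ) 1, ‖g y‖ₑ ≤ ‖g t‖ₑ + D := by
    intro t ht
    have h := intervalIntegral.integral_eq_sub_of_hasDerivAt (a := t) (b := y)
      (fun x _ => hg x) (hc.intervalIntegrable _ _)
    have hle : ‖g y - g t‖ₑ ≤ D := by
      rw [← h, ← enorm_norm, intervalIntegral.norm_intervalIntegral_eq, enorm_norm]
      refine (enorm_integral_le_lintegral_enorm _).trans (lintegral_mono_set ?_)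
      intro s hs
      rw [Set.mem_uIoc] at hs
      constructor
      · rcases hs with hs | hs <;> linarith [hs.1, ht.1, hy.1]
      · rcases hs with hs | hs <;> linarith [hs.2, ht.2, hy.2]
    calc ‖g y‖ₑ = ‖g t + (g y - g t)‖ₑ := by rw [add_sub_cancel]
      _ ≤ ‖g t‖ₑ + ‖g y - g t‖ₑ := enorm_add_le _ _
      _ ≤ ‖g t‖ₑ + D := by gcongr
  calc ‖g y‖ₑ = ∫⁻ _t in Set.Ico (0:ℝ) 1, ‖g y‖ₑ := by simp
    _ ≤ ∫⁻ t in Set.Ico (0:ℝ) 1, (‖g t‖ₑ + D) := setLIntegral_mono' measurableSet_Ico key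
    _ = _ := by rw [lintegral_add_right _ measurable_const]; simp

/-- Cauchy–Schwarz inequality for lower Lebesgue integrals. -/
theorem lintegral_mul_sq_le {α : Type*} [MeasurableSpace α] (μ : Measure α) {u v : α → ENNReal}
    (hu : AEMeasurable u μ) (hv : AEMeasurable v μ) :
    (∫⁻ x, u x * v x ∂μ) ^ 2 ≤ (∫⁻ x, u x ^ 2 ∂μ) * ∫⁻ x, v x ^ 2 ∂μ := by
  have h := ENNReal.lintegral_mul_le_Lp_mul_Lq μ Real.HolderConjugate.two_two hu hv
  have h2 := pow_le_pow_left' h 2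
  simp only [Pi.mul_apply, ENNReal.rpow_ofNat] at h2
  refine h2.trans (le_of_eq ?_)
  rw [mul_pow, ← ENNReal.rpow_natCast, ← ENNReal.rpow_natCast, ← ENNReal.rpow_mul,
    ← ENNReal.rpow_mul]
  norm_num

/-- The `L⁴` bound on the cylinder, of Loomis–Whitney type. -/
theorem lintegral_pow_four_le {f : ℝ × ℝ → ℝ} (hf : ContDiff ℝ 1 f)
    (hi : Integrable (fun x => f x ^ 2) μΩ) :
    ∫⁻ x, ‖f x‖ₑ ^ 4 ∂μΩ ≤ (2 * ∫⁻ x, ‖f x‖ₑ * ‖pd1 f x‖ₑ ∂μΩ) *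
      ((∫⁻ x, ‖f x‖ₑ ^ 2 ∂μΩ) + 2 * ∫⁻ x, ‖f x‖ₑ * ‖pd2 f x‖ₑ ∂μΩ) := by
  have hfm : Measurable fun x => ‖f x‖ₑ := hf.continuous.measurable.enorm
  have h1m : Measurable fun x => ‖pd1 f x‖ₑ := (continuous_pd1 hf).measurable.enorm
  have h2m : Measurable fun x => ‖pd2 f x‖ₑ := (continuous_pd2 hf).measurable.enorm
  have he : ‖(2:ℝ)‖ₑ = 2 := by simp [Real.enorm_eq_ofReal]
  have p1 : Measurable fun x => ‖f x‖ₑ * ‖pd1 f x‖ₑ := hfm.mul h1m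
  have p2 : Measurable fun x => ‖f x‖ₑ * ‖pd2 f x‖ₑ := hfm.mul h2m
  have pf : Measurable fun x => ‖f x‖ₑ ^ 2 := hfm.pow_const 2
  set ν : Measure ℝ := volume.restrict (Set.Ico (0:ℝ) 1) with hν
  set F : ℝ → ENNReal := fun t => ∫⁻ s, 2 * (‖f (s, t)‖ₑ * ‖pd1 f (s, t)‖ₑ) with hF
  set H : ℝ → ENNReal := fun s =>
    ∫⁻ t, (‖f (s, t)‖ₑ ^ 2 + 2 * (‖f (s, t)‖ₑ * ‖pd2 f (s, t)‖ₑ)) ∂ν with hH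
  have m1 : Measurable fun x : ℝ × ℝ => 2 * (‖f x‖ₑ * ‖pd1 f x‖ₑ) :=
    p1.const_mul 2
  have m2 : Measurable fun x : ℝ × ℝ => ‖f x‖ₑ ^ 2 + 2 * (‖f x‖ₑ * ‖pd2 f x‖ₑ) :=
    pf.add (p2.const_mul 2)
  have hFm : Measurable F := m1.lintegral_prod_left'
  have hHm : Measurable H := m2.lintegral_prod_right'
  rw [μΩ_eq_prod] at hi ⊢
  have hFb : ∀ᵐ t ∂ν, ∀ s, ‖f (s, t)‖ₑ ^ 2 ≤ F t := by
    filter_upwards [hi.prod_left_ae] with t ht s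
    have h := enorm_le_lintegral_deriv (g := fun s => f (s, t) ^ 2)
      (g' := fun s => 2 * (f (s, t) * pd1 f (s, t))) (fun s => by
        rw [pd1_eq_fderiv hf]
        exact ((hasDerivAt_pd1 hf (s, t)).fun_pow 2).congr_deriv (by push_cast; ring)) (by
        have := continuous_pd1 hf
        have := hf.continuous
        fun_prop) ht s
    simpa [enorm_mul, he, hF] using h
  have hHb : ∀ᵐ t ∂ν, ∀ s, ‖f (s, t)‖ₑ ^ 2 ≤ H s := by
    filter_upwards [ae_restrict_mem measurableSet_Ico] with t ht s
    have h := enorm_le_lintegral_Ico_add_deriv (g := fun t => f (s, t) ^ 2)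
      (g' := fun t => 2 * (f (s, t) * pd2 f (s, t))) (fun t => by
        rw [pd2_eq_fderiv hf]
        exact ((hasDerivAt_pd2 hf (s, t)).fun_pow 2).congr_deriv (by push_cast; ring)) (by
        have := continuous_pd2 hf
        have := hf.continuous
        fun_prop) ht
    rw [hH]
    dsimp only
    have pfs : Measurable fun t => ‖f (s, t)‖ₑ ^ 2 := pf.comp measurable_prodMk_left
    rw [lintegral_add_left pfs]
    simpa [enorm_mul, he] using h
  have e1 : ∫⁻ t, F t ∂ν =
      2 * ∫⁻ x, ‖f x‖ₑ * ‖pd1 f x‖ₑ ∂(volume : Measure ℝ).prod ν := by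
    rw [← lintegral_const_mul _ p1, lintegral_prod_symm' _ m1]
  have e2 : ∫⁻ s, H s = (∫⁻ x, ‖f x‖ₑ ^ 2 ∂(volume : Measure ℝ).prod ν) +
      2 * ∫⁻ x, ‖f x‖ₑ * ‖pd2 f x‖ₑ ∂(volume : Measure ℝ).prod ν := by
    rw [← lintegral_const_mul _ p2, ← lintegral_add_left pf,
      lintegral_prod _ m2.aemeasurable]
  rw [← e1, ← e2, lintegral_prod_symm' _ (hfm.pow_const 4)]
  calc ∫⁻ t, (∫⁻ s, ‖f (s, t)‖ₑ ^ 4) ∂ν ≤ ∫⁻ t, (∫⁻ s, F t * H s) ∂ν := by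
        refine lintegral_mono_ae ?_
        filter_upwards [hFb, hHb] with t h1 h2
        refine lintegral_mono fun s => ?_
        calc ‖f (s, t)‖ₑ ^ 4 = ‖f (s, t)‖ₑ ^ 2 * ‖f (s, t)‖ₑ ^ 2 := by ring
          _ ≤ F t * H s := mul_le_mul' (h1 s) (h2 s)
    _ = (∫⁻ t, F t ∂ν) * ∫⁻ s, H s := by
        simp_rw [lintegral_const_mul _ hHm]
        rw [lintegral_mul_const _ hFm]

/-- The algebraic conclusion of the Nash argument. -/
theorem le_two_mul_max_of_pow_four_le {A B G : ℝ} (hA : 0 ≤ A) (hB : 0 ≤ B) (hG : 0 ≤ G)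
    (h : B ^ 4 ≤ A ^ 2 * (2 * B * G + 4 * G ^ 2)) :
    B ≤ 2 * max (G ^ ((1:ℝ)/3) * A ^ ((2:ℝ)/3)) (G ^ ((1:ℝ)/2) * A ^ ((1:ℝ)/2)) := by
  rw [mul_max_of_nonneg _ _ zero_le_two, le_max_iff]
  rcases le_total (2 * G) B with hGB | hGB
  · left
    have h3 : B ^ 3 ≤ 4 * (A ^ 2 * G) := by
      rcases hB.eq_or_lt with hB | hB
      · rw [← hB, zero_pow three_ne_zero]
        positivity
      · refine le_of_mul_le_mul_left ?_ hB
        nlinarith [mul_nonneg (mul_nonneg (sq_nonneg A) hG) (sub_nonneg.2 hGB)]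
    refine le_of_pow_le_pow_left₀ three_ne_zero (by positivity) ?_
    have e : (2 * (G ^ ((1:ℝ)/3) * A ^ ((2:ℝ)/3))) ^ 3 = 8 * (A ^ 2 * G) := by
      rw [mul_pow, mul_pow, ← rpow_mul_natCast hG, ← rpow_mul_natCast hA]
      norm_num
      ring
    rw [e]
    nlinarith [mul_nonneg (sq_nonneg A) hG]
  · right
    have h4 : (B ^ 2) ^ 2 ≤ (4 * (G * A)) ^ 2 := by
      nlinarith [mul_nonneg (mul_nonneg (sq_nonneg A) hG) (sub_nonneg.2 hGB),
        sq_nonneg (G * A)]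
    have h2 : B ^ 2 ≤ 4 * (G * A) := le_of_pow_le_pow_left₀ two_ne_zero (by positivity) h4
    refine le_of_pow_le_pow_left₀ two_ne_zero (by positivity) ?_
    rw [mul_pow, mul_pow, ← rpow_mul_natCast hG, ← rpow_mul_natCast hA]
    norm_num
    exact h2

/-- Nash inequality in `ℝ × 𝕋`:
`‖f‖_{L²} ≤ C max { ‖∇f‖_{L²}^{1/3} ‖f‖_{L¹}^{2/3}, ‖∇f‖_{L²}^{1/2} ‖f‖_{L¹}^{1/2} }`. -/
theorem nash_inequality :
    ∃ C > (0:ℝ), ∀ f : ℝ × ℝ → ℝ, ContDiff ℝ 1 f → Periodic2 f →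
      Integrable f μΩ → Integrable (fun x => f x ^ 2) μΩ →
      Integrable (fun x => pd1 f x ^ 2 + pd2 f x ^ 2) μΩ →
      L2norm f ≤ C * max (GradL2norm f ^ ((1:ℝ)/3) * L1norm f ^ ((2:ℝ)/3))
        (GradL2norm f ^ ((1:ℝ)/2) * L1norm f ^ ((1:ℝ)/2)) := by
  refine ⟨2, two_pos, fun f hf _ hf1 hf2 hg => ?_⟩
  have hfm : Measurable fun x => ‖f x‖ₑ := hf.continuous.measurable.enorm
  have h1m : Measurable fun x => ‖pd1 f x‖ₑ := (continuous_pd1 hf).measurable.enorm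
  have h2m : Measurable fun x => ‖pd2 f x‖ₑ := (continuous_pd2 hf).measurable.enorm
  have sq_ofReal : ∀ a : ℝ, ‖a‖ₑ ^ 2 = ENNReal.ofReal (a ^ 2) := fun a => by
    rw [← enorm_pow, Real.enorm_of_nonneg (sq_nonneg a)]
  have ea : ∫⁻ x, ‖f x‖ₑ ∂μΩ = ENNReal.ofReal (L1norm f) :=
    (ofReal_integral_norm_eq_lintegral_enorm hf1).symm
  have eb : ∫⁻ x, ‖f x‖ₑ ^ 2 ∂μΩ = ENNReal.ofReal (L2norm f ^ 2) := by
    have h0 : 0 ≤ ∫ x, f x ^ 2 ∂μΩ := integral_nonneg fun x => sq_nonneg _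
    rw [L2norm, Real.sq_sqrt h0,
      ofReal_integral_eq_lintegral_ofReal hf2 (ae_of_all _ fun x => sq_nonneg _)]
    simp_rw [sq_ofReal]
  have ed : ∫⁻ x, (‖pd1 f x‖ₑ ^ 2 + ‖pd2 f x‖ₑ ^ 2) ∂μΩ = ENNReal.ofReal (GradL2norm f ^ 2) := by
    have h0 : 0 ≤ ∫ x, (pd1 f x ^ 2 + pd2 f x ^ 2) ∂μΩ := integral_nonneg fun x => by positivity
    rw [GradL2norm, Real.sq_sqrt h0,
      ofReal_integral_eq_lintegral_ofReal hg (ae_of_all _ fun x => by positivity)]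
    simp_rw [sq_ofReal, ENNReal.ofReal_add (sq_nonneg _) (sq_nonneg _)]
  have hA : 0 ≤ L1norm f := integral_nonneg fun x => abs_nonneg _
  have hB : 0 ≤ L2norm f := Real.sqrt_nonneg _
  have hG : 0 ≤ GradL2norm f := Real.sqrt_nonneg _
  set A := L1norm f
  set B := L2norm f
  set G := GradL2norm f
  have cs : ∀ v : ℝ × ℝ → ENNReal, Measurable v →
      (∀ x, v x ^ 2 ≤ ‖pd1 f x‖ₑ ^ 2 + ‖pd2 f x‖ₑ ^ 2) →
      ∫⁻ x, ‖f x‖ₑ * v x ∂μΩ ≤ ENNReal.ofReal (B * G) := by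
    intro v hv hle
    refine (ENNReal.pow_le_pow_left_iff two_ne_zero).1 ?_
    calc _ ≤ _ := lintegral_mul_sq_le μΩ hfm.aemeasurable hv.aemeasurable
      _ ≤ ENNReal.ofReal (B ^ 2) * ENNReal.ofReal (G ^ 2) := by
        rw [eb, ← ed]
        exact mul_le_mul_right (lintegral_mono hle) _
      _ = _ := by
        rw [← ENNReal.ofReal_mul (by positivity), ← ENNReal.ofReal_pow (by positivity), mul_pow]
  have hL4 : ∫⁻ x, ‖f x‖ₑ ^ 4 ∂μΩ ≤ ENNReal.ofReal (2 * (B * G) * (B ^ 2 + 2 * (B * G))) := by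
    refine (lintegral_pow_four_le hf hf2).trans ?_
    rw [ENNReal.ofReal_mul (by positivity), ENNReal.ofReal_add (by positivity) (by positivity),
      ENNReal.ofReal_mul zero_le_two, ENNReal.ofReal_ofNat, eb]
    gcongr
    · exact cs _ h1m fun x => le_self_add
    · exact cs _ h2m fun x => le_add_self
  have hb3 : (∫⁻ x, ‖f x‖ₑ ^ 2 ∂μΩ) ^ 2 ≤ (∫⁻ x, ‖f x‖ₑ ∂μΩ) * ∫⁻ x, ‖f x‖ₑ ^ 3 ∂μΩ := by
    have h := lintegral_mul_sq_le μΩ (hfm.pow_const (1/2 : ℝ)).aemeasurable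
      (hfm.pow_const (3/2 : ℝ)).aemeasurable
    have e1 : ∀ a : ENNReal, a ^ (1/2 : ℝ) * a ^ (3/2 : ℝ) = a ^ 2 := fun a => by
      rw [← ENNReal.rpow_add_of_nonneg _ _ (by norm_num) (by norm_num), ← ENNReal.rpow_natCast]
      norm_num
    have e2 : ∀ a : ENNReal, (a ^ (1/2 : ℝ)) ^ 2 = a := fun a => by
      rw [← ENNReal.rpow_mul_natCast]
      norm_num
    have e3 : ∀ a : ENNReal, (a ^ (3/2 : ℝ)) ^ 2 = a ^ 3 := fun a => by
      rw [← ENNReal.rpow_mul_natCast, ← ENNReal.rpow_natCast]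
      norm_num
    simpa only [e1, e2, e3] using h
  have h34 : (∫⁻ x, ‖f x‖ₑ ^ 3 ∂μΩ) ^ 2 ≤ (∫⁻ x, ‖f x‖ₑ ^ 2 ∂μΩ) * ∫⁻ x, ‖f x‖ₑ ^ 4 ∂μΩ := by
    have h := lintegral_mul_sq_le μΩ hfm.aemeasurable (hfm.pow_const 2).aemeasurable
    simpa only [← pow_mul, ← pow_succ'] using h
  have hreal : B ^ 8 ≤ A ^ 2 * (B ^ 2 * (2 * (B * G) * (B ^ 2 + 2 * (B * G)))) := by
    rw [← ENNReal.ofReal_le_ofReal_iff (by positivity), ENNReal.ofReal_mul (by positivity),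
      ENNReal.ofReal_mul (by positivity), ENNReal.ofReal_pow hA, ← ea, ← eb]
    calc ENNReal.ofReal (B ^ 8) = ((∫⁻ x, ‖f x‖ₑ ^ 2 ∂μΩ) ^ 2) ^ 2 := by
          rw [eb, ← ENNReal.ofReal_pow (by positivity), ← ENNReal.ofReal_pow (by positivity)]
          ring_nf
      _ ≤ ((∫⁻ x, ‖f x‖ₑ ∂μΩ) * ∫⁻ x, ‖f x‖ₑ ^ 3 ∂μΩ) ^ 2 := by gcongr
      _ = (∫⁻ x, ‖f x‖ₑ ∂μΩ) ^ 2 * (∫⁻ x, ‖f x‖ₑ ^ 3 ∂μΩ) ^ 2 := mul_pow _ _ _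
      _ ≤ _ := by
        gcongr
        refine h34.trans ?_
        gcongr
  refine le_two_mul_max_of_pow_four_le hA hB hG ?_
  rcases hB.eq_or_lt with h0 | hpos
  · rw [← h0, zero_pow four_ne_zero]
    positivity
  · refine le_of_mul_le_mul_left ?_ (pow_pos hpos 4)
    linarith

end NS
end
end

section
/- (Gaussian upper bound) For every λ ∈ (0,1) there exists a constant K₂ > 0, independent of u, with the following property. Let u be a smooth divergence-free vector field on Ω × [0,∞) whose first component satisfies ∫₀¹ u₁(x₁,x₂,t) dx₂ = 0 for all x₁, t and sup_{t≥0} ‖u₁(·,t)‖_{L∞(Ω)} ≤ M for some M ≥ 0. Then every smooth bounded solution ω of ∂_t ω + u·∇ω = Δω on Ω × (0,∞) with continuous compactly supported initial data ω₀ satisfies, for all x ∈ Ω and t > 0, |ω(x,t)| ≤ (K₂/V(t)) ∫_Ω exp( −λ |x₁ − y₁|² / (4(1+M²)t) ) |ω₀(y)| dy. -/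
noncomputable section

open MeasureTheory Real

namespace NS

/-- `V(t) = min(t, √t)`. -/
def Vmin (t : ℝ) : ℝ := min t (Real.sqrt t)

/-! ### Partial derivatives and integration by parts on a rectangle -/

lemma hasDerivAt_slice1 {g : ℝ × ℝ → ℝ} {x : ℝ × ℝ} (h : DifferentiableAt ℝ g x) :
    HasDerivAt (fun y => g (y, x.2)) (fderiv ℝ g x (1, 0)) x.1 := by
  have h1 : HasDerivAt (fun y : ℝ => (y, x.2)) ((1 : ℝ), (0 : ℝ)) x.1 :=
    (hasDerivAt_id _).prodMk (hasDerivAt_const _ _)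
  exact HasFDerivAt.comp_hasDerivAt x.1 (f := fun y : ℝ => (y, x.2)) h.hasFDerivAt h1

lemma hasDerivAt_slice2 {g : ℝ × ℝ → ℝ} {x : ℝ × ℝ} (h : DifferentiableAt ℝ g x) :
    HasDerivAt (fun y => g (x.1, y)) (fderiv ℝ g x (0, 1)) x.2 := by
  have h1 : HasDerivAt (fun y : ℝ => (x.1, y)) ((0 : ℝ), (1 : ℝ)) x.2 :=
    (hasDerivAt_const _ _).prodMk (hasDerivAt_id _)
  exact HasFDerivAt.comp_hasDerivAt x.2 (f := fun y : ℝ => (x.1, y)) h.hasFDerivAt h1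

lemma pd1_eq_fderiv_s8 {g : ℝ × ℝ → ℝ} {x : ℝ × ℝ} (h : DifferentiableAt ℝ g x) :
    pd1 g x = fderiv ℝ g x (1, 0) := (hasDerivAt_slice1 h).deriv

lemma pd2_eq_fderiv_s8 {g : ℝ × ℝ → ℝ} {x : ℝ × ℝ} (h : DifferentiableAt ℝ g x) :
    pd2 g x = fderiv ℝ g x (0, 1) := (hasDerivAt_slice2 h).deriv

lemma hasDerivAt_pd1_s8 {g : ℝ × ℝ → ℝ} {x : ℝ × ℝ} (h : DifferentiableAt ℝ g x) :
    HasDerivAt (fun y => g (y, x.2)) (pd1 g x) x.1 := by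
  rw [pd1_eq_fderiv_s8 h]; exact hasDerivAt_slice1 h

lemma hasDerivAt_pd2_s8 {g : ℝ × ℝ → ℝ} {x : ℝ × ℝ} (h : DifferentiableAt ℝ g x) :
    HasDerivAt (fun y => g (x.1, y)) (pd2 g x) x.2 := by
  rw [pd2_eq_fderiv_s8 h]; exact hasDerivAt_slice2 h

lemma contDiff_pd1 {g : ℝ × ℝ → ℝ} {n : ℕ} (h : ContDiff ℝ (n + 1) g) :
    ContDiff ℝ n (pd1 g) := by
  have hd : Differentiable ℝ g := h.differentiable (by simp)
  have : pd1 g = fun x => fderiv ℝ g x (1, 0) := funext fun x => pd1_eq_fderiv_s8 (hd x)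
  rw [this]
  exact (h.fderiv_right le_rfl).clm_apply contDiff_const

lemma contDiff_pd2 {g : ℝ × ℝ → ℝ} {n : ℕ} (h : ContDiff ℝ (n + 1) g) :
    ContDiff ℝ n (pd2 g) := by
  have hd : Differentiable ℝ g := h.differentiable (by simp)
  have : pd2 g = fun x => fderiv ℝ g x (0, 1) := funext fun x => pd2_eq_fderiv_s8 (hd x)
  rw [this]
  exact (h.fderiv_right le_rfl).clm_apply contDiff_const

/-- The rectangle `[-L, L] × [0, 1]`. -/
def rect (L : ℝ) : Set (ℝ × ℝ) := Set.Icc (-L, 0) (L, 1)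

lemma rect_eq_prod (L : ℝ) : rect L = Set.Icc (-L) L ×ˢ Set.Icc (0 : ℝ) 1 := by
  rw [rect, Set.Icc_prod_eq]

lemma isCompact_rect (L : ℝ) : IsCompact (rect L) := isCompact_Icc

lemma measurableSet_rect (L : ℝ) : MeasurableSet (rect L) := measurableSet_Icc

lemma integrableOn_rect {f : ℝ × ℝ → ℝ} (hf : Continuous f) (L : ℝ) :
    IntegrableOn f (rect L) := hf.continuousOn.integrableOn_compact (isCompact_rect L)

lemma setIntegral_rect {f : ℝ × ℝ → ℝ} (hf : Continuous f) {L : ℝ} (hL : 0 ≤ L) :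
    ∫ x in rect L, f x = ∫ x₁ in (-L)..L, ∫ x₂ in (0 : ℝ)..1, f (x₁, x₂) := by
  have h := integrableOn_rect hf L
  rw [rect_eq_prod, Measure.volume_eq_prod] at h ⊢
  rw [setIntegral_prod _ h, intervalIntegral.integral_of_le (by linarith),
    integral_Icc_eq_integral_Ioc]
  simp only [intervalIntegral.integral_of_le zero_le_one, integral_Icc_eq_integral_Ioc]

lemma setIntegral_rect_symm {f : ℝ × ℝ → ℝ} (hf : Continuous f) {L : ℝ} (hL : 0 ≤ L) :
    ∫ x in rect L, f x = ∫ x₂ in (0 : ℝ)..1, ∫ x₁ in (-L)..L, f (x₁, x₂) := by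
  have h := integrableOn_rect hf L
  rw [rect_eq_prod, Measure.volume_eq_prod] at h ⊢
  rw [IntegrableOn, ← Measure.prod_restrict] at h
  rw [← Measure.prod_restrict, integral_prod_symm _ h,
    intervalIntegral.integral_of_le zero_le_one, integral_Icc_eq_integral_Ioc]
  simp only [intervalIntegral.integral_of_le (show -L ≤ L by linarith),
    integral_Icc_eq_integral_Ioc]

lemma setIntegral_rect_divergence {L : ℝ} (hL : 0 ≤ L) {G₁ G₂ : ℝ × ℝ → ℝ}
    (h1 : ContDiff ℝ 1 G₁) (h2 : ContDiff ℝ 1 G₂)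
    (hs : ∀ x : ℝ × ℝ, L ≤ |x.1| → G₁ x = 0)
    (hp : ∀ x : ℝ × ℝ, G₂ (x.1, x.2 + 1) = G₂ x) :
    ∫ x in rect L, (pd1 G₁ x + pd2 G₂ x) = 0 := by
  have d1 := h1.differentiable one_ne_zero
  have d2 := h2.differentiable one_ne_zero
  have key := integral_divergence_prod_Icc_of_hasFDerivAt_of_le G₁ G₂ (fderiv ℝ G₁) (fderiv ℝ G₂)
    (-L, 0) (L, 1) (by constructor <;> simp; linarith) h1.continuous.continuousOn
    h2.continuous.continuousOn (fun x _ => (d1 x).hasFDerivAt) (fun x _ => (d2 x).hasFDerivAt)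
    (by
      apply integrableOn_rect
      have e1 := h1.continuous_fderiv one_ne_zero
      have e2 := h2.continuous_fderiv one_ne_zero
      fun_prop)
  have e : ∀ x, pd1 G₁ x + pd2 G₂ x = fderiv ℝ G₁ x (1, 0) + fderiv ℝ G₂ x (0, 1) := fun x => by
    rw [pd1_eq_fderiv_s8 (d1 x), pd2_eq_fderiv_s8 (d2 x)]
  simp only [e]
  rw [rect, key]
  have a1 : ∀ y, G₁ (L, y) = 0 := fun y => hs _ (le_abs_self _)
  have a2 : ∀ y, G₁ (-L, y) = 0 := fun y => hs _ (by simp [le_abs_self])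
  have a3 : ∀ y, G₂ (y, 1) = G₂ (y, 0) := fun y => by simpa using hp (y, 0)
  simp [a1, a2, a3]

/-- A mean-zero function `w` with `|w| ≤ M` is the derivative of a function bounded by `M / 2`
vanishing at the endpoints. -/
lemma abs_primitive_le_of_integral_eq_zero {w : ℝ → ℝ} {M : ℝ} (hw : Continuous w)
    (hM : ∀ x, |w x| ≤ M) (h0 : ∫ x in (0 : ℝ)..1, w x = 0) {x : ℝ} (hx0 : 0 ≤ x) (hx1 : x ≤ 1) :
    |∫ y in (0 : ℝ)..x, w y| ≤ M / 2 := by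
  have hi : ∀ a b, IntervalIntegrable w volume a b := fun a b => hw.intervalIntegrable a b
  have b1 : |∫ y in (0 : ℝ)..x, w y| ≤ M * |x - 0| :=
    intervalIntegral.norm_integral_le_of_norm_le_const (f := w) fun y _ => hM y
  have b2 : |∫ y in x..1, w y| ≤ M * |1 - x| :=
    intervalIntegral.norm_integral_le_of_norm_le_const (f := w) fun y _ => hM y
  have hsum := intervalIntegral.integral_add_adjacent_intervals (hi 0 x) (hi x 1)
  rw [h0] at hsum
  have : |∫ y in (0 : ℝ)..x, w y| = |∫ y in x..1, w y| := by
    rw [show (∫ y in (0 : ℝ)..x, w y) = -∫ y in x..1, w y by linarith, abs_neg]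
  rw [abs_of_nonneg (show 0 ≤ x - 0 by linarith)] at b1
  rw [abs_of_nonneg (show 0 ≤ 1 - x by linarith)] at b2
  linarith

lemma abs_integral_mul_le_of_integral_eq_zero {w v v' : ℝ → ℝ} {M : ℝ} (hw : Continuous w)
    (hM : ∀ x, |w x| ≤ M) (h0 : ∫ x in (0 : ℝ)..1, w x = 0) (hv : ∀ x, HasDerivAt v (v' x) x)
    (hv' : Continuous v') :
    |∫ x in (0 : ℝ)..1, w x * v x| ≤ M / 2 * ∫ x in (0 : ℝ)..1, |v' x| := by
  set H : ℝ → ℝ := fun x => ∫ y in (0 : ℝ)..x, w y with hH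
  have hHd : ∀ x, HasDerivAt H (w x) x := fun x => hw.integral_hasStrictDerivAt 0 x |>.hasDerivAt
  have hHc : Continuous H := continuous_iff_continuousAt.2 fun x => (hHd x).continuousAt
  have ibp := intervalIntegral.integral_mul_deriv_eq_deriv_mul (a := 0) (b := 1)
    (u := H) (u' := w) (v := v) (v' := v') (fun x _ => hHd x) (fun x _ => hv x)
    (hw.intervalIntegrable 0 1) (hv'.intervalIntegrable 0 1)
  have H1 : H 1 = 0 := h0
  have H0 : H 0 = 0 := by simp [hH]
  rw [H1, H0] at ibp
  have : (∫ x in (0 : ℝ)..1, w x * v x) = -∫ x in (0 : ℝ)..1, H x * v' x := by linarith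
  rw [this, abs_neg, ← intervalIntegral.integral_const_mul]
  refine (intervalIntegral.abs_integral_le_integral_abs zero_le_one).trans ?_
  refine intervalIntegral.integral_mono_on zero_le_one
    ((hHc.mul hv').abs.intervalIntegrable _ _)
    ((continuous_const.mul hv'.abs).intervalIntegrable _ _) fun x hx => ?_
  rw [abs_mul]
  exact mul_le_mul_of_nonneg_right
    (abs_primitive_le_of_integral_eq_zero hw hM h0 hx.1 hx.2) (abs_nonneg _)

/-! ### A logarithmic Sobolev inequality on the cylinder -/

lemma abs_le_half_integral_abs_deriv {v v' : ℝ → ℝ} {a b x : ℝ} (hv : ∀ y, HasDerivAt v (v' y) y)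
    (hv' : Continuous v') (ha : v a = 0) (hb : v b = 0) (hax : a ≤ x) (hxb : x ≤ b) :
    |v x| ≤ 1 / 2 * ∫ y in a..b, |v' y| := by
  have hi : ∀ c d, IntervalIntegrable v' volume c d := fun c d => hv'.intervalIntegrable c d
  have e1 := intervalIntegral.integral_eq_sub_of_hasDerivAt (fun y _ => hv y) (hi a x)
  have e2 := intervalIntegral.integral_eq_sub_of_hasDerivAt (fun y _ => hv y) (hi x b)
  have i1 := intervalIntegral.abs_integral_le_integral_abs (f := v') (μ := volume) hax
  have i2 := intervalIntegral.abs_integral_le_integral_abs (f := v') (μ := volume) hxb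
  rw [e1, ha, sub_zero] at i1
  rw [e2, hb, zero_sub, abs_neg] at i2
  have := intervalIntegral.integral_add_adjacent_intervals (hi a x).abs (hi x b).abs
  linarith

lemma le_integral_add_integral_abs_deriv {v v' : ℝ → ℝ} {x : ℝ}
    (hv : ∀ y, HasDerivAt v (v' y) y) (hv' : Continuous v') (hx0 : 0 ≤ x) (hx1 : x ≤ 1) :
    v x ≤ (∫ y in (0 : ℝ)..1, v y) + ∫ y in (0 : ℝ)..1, |v' y| := by
  have hvc : Continuous v := continuous_iff_continuousAt.2 fun y => (hv y).continuousAt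
  have key : ∀ y ∈ Set.Icc (0 : ℝ) 1, v x ≤ v y + ∫ z in (0 : ℝ)..1, |v' z| := by
    intro y hy
    have e1 := intervalIntegral.integral_eq_sub_of_hasDerivAt (fun z _ => hv z)
      (hv'.intervalIntegrable y x)
    have i1 : |∫ z in y..x, v' z| ≤ |(∫ z in y..x, |v' z|)| :=
      intervalIntegral.norm_integral_le_abs_integral_norm (f := v')
    have i2 : |(∫ z in y..x, |v' z|)| ≤ |(∫ z in (0 : ℝ)..1, |v' z|)| := by
      apply intervalIntegral.abs_integral_mono_interval
      · rw [Set.uIoc_of_le zero_le_one]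
        intro z hz
        rcases le_total y x with h | h
        · rw [Set.uIoc_of_le h] at hz
          exact ⟨lt_of_le_of_lt hy.1 hz.1, hz.2.trans hx1⟩
        · rw [Set.uIoc_of_ge h] at hz
          exact ⟨lt_of_le_of_lt hx0 hz.1, hz.2.trans hy.2⟩
      · exact Filter.Eventually.of_forall fun z => abs_nonneg _
      · exact hv'.abs.intervalIntegrable _ _
    rw [abs_of_nonneg (intervalIntegral.integral_nonneg zero_le_one fun z _ => abs_nonneg (v' z))]
      at i2
    have := le_abs_self (∫ z in y..x, v' z)
    linarith
  have := intervalIntegral.integral_mono_on zero_le_one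
    (intervalIntegrable_const (c := v x) (μ := volume))
    ((hvc.add continuous_const).intervalIntegrable 0 1) key
  simp only [Pi.add_apply] at this
  rw [intervalIntegral.integral_add (hvc.intervalIntegrable _ _) intervalIntegrable_const] at this
  simpa using this

lemma continuous_pd1_s8 {g : ℝ × ℝ → ℝ} (h : ContDiff ℝ 1 g) : Continuous (pd1 g) :=
  (contDiff_pd1 (n := 0) (by simpa using h)).continuous

lemma continuous_pd2_s8 {g : ℝ × ℝ → ℝ} (h : ContDiff ℝ 1 g) : Continuous (pd2 g) :=
  (contDiff_pd2 (n := 0) (by simpa using h)).continuous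

lemma integral_pow_four_le {L : ℝ} (hL : 0 ≤ L) {g : ℝ × ℝ → ℝ} (hg : ContDiff ℝ 1 g)
    (hs : ∀ x : ℝ × ℝ, L ≤ |x.1| → g x = 0) :
    ∫ x in rect L, g x ^ 4 ≤ (∫ x in rect L, |g x * pd1 g x|) *
      ((∫ x in rect L, g x ^ 2) + 2 * ∫ x in rect L, |g x * pd2 g x|) := by
  have hd := hg.differentiable one_ne_zero
  have c0 := hg.continuous
  have c1 := continuous_pd1_s8 hg
  have c2 := continuous_pd2_s8 hg
  set A : ℝ → ℝ := fun x₂ => ∫ y in (-L)..L, |g (y, x₂) * pd1 g (y, x₂)| with hA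
  set B : ℝ → ℝ := fun x₁ => ∫ y in (0 : ℝ)..1, (g (x₁, y) ^ 2 + 2 * |g (x₁, y) * pd2 g (x₁, y)|)
    with hB
  have hAc : Continuous A :=
    intervalIntegral.continuous_parametric_intervalIntegral_of_continuous' (by fun_prop) _ _
  have hBc : Continuous B :=
    intervalIntegral.continuous_parametric_intervalIntegral_of_continuous' (by fun_prop) _ _
  have hgA : ∀ x ∈ rect L, g x ^ 2 ≤ A x.2 := by
    intro x hx
    rw [rect_eq_prod] at hx
    have := abs_le_half_integral_abs_deriv (v := fun y => g (y, x.2) ^ 2)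
      (v' := fun y => 2 * (g (y, x.2) * pd1 g (y, x.2))) (a := -L) (b := L) (x := x.1)
      (fun y => by
        exact ((hasDerivAt_pd1_s8 (hd (y, x.2))).fun_pow 2).congr_deriv (by push_cast; ring)) (by fun_prop)
      (by simp [hs (-L, x.2) (by simp [le_abs_self])]) (by simp [hs (L, x.2) (le_abs_self _)])
      hx.1.1 hx.1.2
    simp only [abs_mul, abs_two, intervalIntegral.integral_const_mul] at this
    rw [abs_of_nonneg (sq_nonneg _)] at this
    simp only [hA, abs_mul]
    linarith
  have hgB : ∀ x ∈ rect L, g x ^ 2 ≤ B x.1 := by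
    intro x hx
    rw [rect_eq_prod] at hx
    have := le_integral_add_integral_abs_deriv (v := fun y => g (x.1, y) ^ 2)
      (v' := fun y => 2 * (g (x.1, y) * pd2 g (x.1, y))) (x := x.2)
      (fun y => by
        exact ((hasDerivAt_pd2_s8 (hd (x.1, y))).fun_pow 2).congr_deriv (by push_cast; ring)) (by fun_prop) hx.2.1 hx.2.2
    simp only [hB]
    rw [intervalIntegral.integral_add
      (Continuous.intervalIntegrable (by fun_prop) _ _)
      (Continuous.intervalIntegrable (by fun_prop) _ _)]
    simpa [abs_mul] using this
  have step : ∫ x in rect L, g x ^ 4 ≤ ∫ x in rect L, B x.1 * A x.2 := by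
    refine setIntegral_mono_on (integrableOn_rect (by fun_prop) L)
      (integrableOn_rect (by fun_prop) L) (measurableSet_rect L) fun x hx => ?_
    calc g x ^ 4 = g x ^ 2 * g x ^ 2 := by ring
      _ ≤ B x.1 * A x.2 := mul_le_mul (hgB x hx) (hgA x hx) (sq_nonneg _)
          ((sq_nonneg _).trans (hgB x hx))
  refine step.trans (le_of_eq ?_)
  rw [rect_eq_prod, Measure.volume_eq_prod, setIntegral_prod_mul, ← Measure.volume_eq_prod,
    ← rect_eq_prod, mul_comm]
  congr 1
  · rw [setIntegral_rect_symm (by fun_prop) hL, integral_Icc_eq_integral_Ioc,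
      ← intervalIntegral.integral_of_le zero_le_one]
  · rw [← integral_const_mul, ← integral_add (integrableOn_rect (by fun_prop) L)
      (integrableOn_rect (by fun_prop) L), setIntegral_rect (by fun_prop) hL,
      integral_Icc_eq_integral_Ioc, ← intervalIntegral.integral_of_le (by linarith)]

lemma sq_integral_abs_mul_le {L : ℝ} {g h : ℝ × ℝ → ℝ} (hg : Continuous g) (hh : Continuous h)
    (h1 : ∫ x in rect L, g x ^ 2 = 1) :
    (∫ x in rect L, |g x * h x|) ^ 2 ≤ ∫ x in rect L, h x ^ 2 := by
  set A := ∫ x in rect L, |g x * h x| with hA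
  have : ∫ x in rect L, 2 * A * |g x * h x| ≤ ∫ x in rect L, (A ^ 2 * g x ^ 2 + h x ^ 2) := by
    refine setIntegral_mono_on (integrableOn_rect (by fun_prop) L)
      (integrableOn_rect (by fun_prop) L) (measurableSet_rect L) fun x _ => ?_
    rw [abs_mul]
    nlinarith [sq_nonneg (A * |g x| - |h x|), sq_abs (g x), sq_abs (h x)]
  rw [integral_const_mul, integral_add (integrableOn_rect (by fun_prop) L)
    (integrableOn_rect (by fun_prop) L), integral_const_mul, h1] at this
  nlinarith

lemma sq_mul_log_sq_le {c : ℝ} (hc : 0 < c) (y : ℝ) :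
    y ^ 2 * log (y ^ 2) ≤ y ^ 4 / c + (log c - 1) * y ^ 2 := by
  rcases eq_or_ne y 0 with rfl | hy
  · simp
  have hy2 : 0 < y ^ 2 := by positivity
  have h := log_le_sub_one_of_pos (div_pos hy2 hc)
  rw [log_div hy2.ne' hc.ne'] at h
  have := mul_le_mul_of_nonneg_left h hy2.le
  have e : y ^ 4 / c = y ^ 2 * (y ^ 2 / c) := by ring
  rw [e]; linarith

lemma continuous_sq_mul_log_sq {g : ℝ × ℝ → ℝ} (hg : Continuous g) :
    Continuous fun x => g x ^ 2 * log (g x ^ 2) :=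
  Real.continuous_mul_log.comp (hg.pow 2)

/-- A logarithmic Sobolev inequality, adapted to the volume growth of the cylinder. -/
lemma integral_sq_mul_log_sq_le {L : ℝ} (hL : 0 ≤ L) {g : ℝ × ℝ → ℝ} (hg : ContDiff ℝ 1 g)
    (hs : ∀ x : ℝ × ℝ, L ≤ |x.1| → g x = 0) (h1 : ∫ x in rect L, g x ^ 2 = 1)
    {v ε : ℝ} (hv : 0 < v) (hvε : v ≤ ε) (hvε2 : v ^ 2 ≤ ε) :
    ∫ x in rect L, g x ^ 2 * log (g x ^ 2) <
      ε * (∫ x in rect L, (pd1 g x ^ 2 + pd2 g x ^ 2)) + log (2 / v) := by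
  have c0 := hg.continuous
  have c1 := continuous_pd1_s8 hg
  have c2 := continuous_pd2_s8 hg
  have hc : 0 < 2 / v := by positivity
  have s1 : ∫ x in rect L, g x ^ 2 * log (g x ^ 2) ≤
      ∫ x in rect L, (g x ^ 4 / (2 / v) + (log (2 / v) - 1) * g x ^ 2) :=
    setIntegral_mono_on (integrableOn_rect (continuous_sq_mul_log_sq c0) L)
      (integrableOn_rect (by fun_prop) L) (measurableSet_rect L)
      fun x _ => sq_mul_log_sq_le hc _
  rw [integral_add (integrableOn_rect (by fun_prop) L)
    (integrableOn_rect (by fun_prop) L), integral_const_mul, h1, integral_div] at s1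
  rw [integral_add (integrableOn_rect (by fun_prop) L) (integrableOn_rect (by fun_prop) L)]
  have s2 := integral_pow_four_le hL hg hs
  rw [h1] at s2
  have s3 := sq_integral_abs_mul_le c0 c1 h1
  have s4 := sq_integral_abs_mul_le c0 c2 h1
  set A := ∫ x in rect L, |g x * pd1 g x|
  set B := ∫ x in rect L, |g x * pd2 g x|
  set D₁ := ∫ x in rect L, pd1 g x ^ 2
  set D₂ := ∫ x in rect L, pd2 g x ^ 2
  set I := ∫ x in rect L, g x ^ 4
  have e : I / (2 / v) = v * I / 2 := by field_simp
  rw [e] at s1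
  have s5 : v * I ≤ v * A + v * (A ^ 2 + B ^ 2) := by
    have : I ≤ A + (A ^ 2 + B ^ 2) := by nlinarith [sq_nonneg (A - B)]
    nlinarith
  have s6 : v * A ≤ (1 + ε * D₁) / 2 := by
    have : v ^ 2 * A ^ 2 ≤ ε * D₁ := mul_le_mul hvε2 s3 (sq_nonneg _) (by linarith)
    nlinarith [sq_nonneg (v * A - 1)]
  have s7 : v * (A ^ 2 + B ^ 2) ≤ ε * (D₁ + D₂) :=
    mul_le_mul hvε (by linarith) (by positivity) (by linarith)
  have : 0 ≤ ε * D₁ := mul_nonneg (by linarith) ((sq_nonneg _).trans s3)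
  have : 0 ≤ ε * D₂ := mul_nonneg (by linarith) ((sq_nonneg _).trans s4)
  nlinarith

/-! ### The energy estimate at a fixed time -/

/-- The drift term only sees the bounded stream function of the mean-zero field `w`. -/
lemma integral_drift_le {L M : ℝ} (hL : 0 ≤ L) {g w : ℝ × ℝ → ℝ} {c : ℝ → ℝ}
    (hg : ContDiff ℝ 1 g) (hw : Continuous w) (hc : Continuous c)
    (hM : ∀ x, |w x| ≤ M)
    (hmean : ∀ x₁, ∫ x₂ in (0 : ℝ)..1, w (x₁, x₂) = 0) :
    ∫ x in rect L, -(c x.1 * w x * g x ^ 2) ≤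
      ∫ x in rect L, M * |c x.1| * |g x * pd2 g x| := by
  have hd := hg.differentiable one_ne_zero
  have c0 := hg.continuous
  have c2 := continuous_pd2_s8 hg
  rw [setIntegral_rect (by fun_prop) hL, setIntegral_rect (by fun_prop) hL]
  refine intervalIntegral.integral_mono_on (by linarith) ?_ ?_ fun x₁ _ => ?_
  · exact (intervalIntegral.continuous_parametric_intervalIntegral_of_continuous'
      (by fun_prop) _ _).intervalIntegrable _ _
  · exact (intervalIntegral.continuous_parametric_intervalIntegral_of_continuous'
      (by fun_prop) _ _).intervalIntegrable _ _
  have key := abs_integral_mul_le_of_integral_eq_zero (w := fun y => w (x₁, y)) (M := M)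
    (v := fun y => g (x₁, y) ^ 2) (v' := fun y => 2 * (g (x₁, y) * pd2 g (x₁, y)))
    (by fun_prop) (fun y => hM _) (hmean x₁)
    (fun y => ((hasDerivAt_pd2_s8 (hd (x₁, y))).fun_pow 2).congr_deriv (by push_cast; ring))
    (by fun_prop)
  have e1 : ∫ y in (0 : ℝ)..1, -(c x₁ * w (x₁, y) * g (x₁, y) ^ 2) =
      -c x₁ * ∫ y in (0 : ℝ)..1, w (x₁, y) * g (x₁, y) ^ 2 := by
    rw [← intervalIntegral.integral_const_mul]; congr 1; ext y; ring
  have e2 : ∫ y in (0 : ℝ)..1, M * |c x₁| * |g (x₁, y) * pd2 g (x₁, y)| =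
      |c x₁| * (M / 2 * ∫ y in (0 : ℝ)..1, |2 * (g (x₁, y) * pd2 g (x₁, y))|) := by
    rw [← intervalIntegral.integral_const_mul, ← intervalIntegral.integral_const_mul]
    congr 1; ext y; rw [abs_mul 2, abs_two]; ring
  simp only
  rw [e1, e2]
  refine (le_abs_self _).trans ?_
  rw [abs_mul, abs_neg]
  exact mul_le_mul_of_nonneg_left key (abs_nonneg _)

/-- The right-hand side of the pointwise differential inequality satisfied by the square of the
weighted power `g` of a subsolution, in the parametrization `ρ = 1 - 1 / p`. -/
def energyDensity (T M ρ a k ν : ℝ) (u g : ℝ × ℝ → ℝ) (w : ℝ × ℝ → ℝ) (x : ℝ × ℝ) : ℝ :=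
  g x ^ 2 * log (g x ^ 2)
    - ((6 * T * ρ * (1 - ρ) + 3 / 4 * T * M ^ 2) * (k * (x.1 - a)) ^ 2 + ν) * g x ^ 2
    + 6 * T * ρ * (1 - ρ) * ((1 - ρ) * (2 * g x * pd1 (pd1 g) x + 2 * g x * pd2 (pd2 g) x
        - 2 * g x * pd1 g x * u x - 2 * g x * pd2 g x * w x)
      - (1 - ρ) * (2 - 4 * (1 - ρ)) * (pd1 g x ^ 2 + pd2 g x ^ 2)
      + (k + (k * (x.1 - a)) ^ 2) * g x ^ 2
      + 4 * (1 - ρ) * (k * (x.1 - a)) * g x * pd1 g x - k * (x.1 - a) * u x * g x ^ 2)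

lemma integral_energyDensity_neg {L T M ρ a k ν v : ℝ} {u w g : ℝ × ℝ → ℝ} (hL : 0 ≤ L)
    (hT : 0 < T) (hρ0 : 0 < ρ) (hρ1 : ρ < 1) (hk : 0 ≤ k)
    (hg : ContDiff ℝ 2 g) (hper : ∀ x : ℝ × ℝ, g (x.1, x.2 + 1) = g x)
    (hs : ∀ x : ℝ × ℝ, L ≤ |x.1| → g x = 0) (h1 : ∫ x in rect L, g x ^ 2 = 1)
    (hu : ContDiff ℝ 1 u) (hw : ContDiff ℝ 1 w)
    (hwper : ∀ x : ℝ × ℝ, w (x.1, x.2 + 1) = w x)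
    (hdiv : ∀ x, pd1 u x + pd2 w x = 0)
    (hmean : ∀ x₁, ∫ x₂ in (0 : ℝ)..1, u (x₁, x₂) = 0) (hM : ∀ x, |u x| ≤ M)
    (hv : 0 < v) (hv1 : v ≤ 12 * T * ρ ^ 2 * (1 - ρ) ^ 2)
    (hv2 : v ^ 2 ≤ 12 * T * ρ ^ 2 * (1 - ρ) ^ 2)
    (hν : log (2 / v) + 6 * T * ρ * (1 - ρ) * k ≤ ν) :
    ∫ x in rect L, energyDensity T M ρ a k ν u g w x < 0 := by
  have hM0 : 0 ≤ M := (abs_nonneg _).trans (hM 0)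
  have hg1 : ContDiff ℝ 1 g := hg.of_le one_le_two
  have hp1 : ContDiff ℝ 1 (pd1 g) := contDiff_pd1 (n := 1) (by norm_num; exact hg)
  have hp2 : ContDiff ℝ 1 (pd2 g) := contDiff_pd2 (n := 1) (by norm_num; exact hg)
  have c0 := hg1.continuous
  have c1 := continuous_pd1_s8 hg1
  have c2 := continuous_pd2_s8 hg1
  have c3 := hu.continuous
  have dg := hg1.differentiable one_ne_zero
  have dg1 := hp1.differentiable one_ne_zero
  have dg2 := hp2.differentiable one_ne_zero
  have du := hu.differentiable one_ne_zero
  have dw := hw.differentiable one_ne_zero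
  obtain ⟨σ, hσ⟩ : ∃ σ, σ = 6 * T * ρ * (1 - ρ) := ⟨_, rfl⟩
  have hr : 0 < 1 - ρ := by linarith
  have hσ0 : 0 < σ := by rw [hσ]; positivity
  set G₁ : ℝ × ℝ → ℝ := fun x => 2 * g x * pd1 g x + (2 * (k * (x.1 - a)) - u x) * g x ^ 2
    with hG₁
  set G₂ : ℝ × ℝ → ℝ := fun x => 2 * g x * pd2 g x - w x * g x ^ 2 with hG₂
  set Y : ℝ × ℝ → ℝ := fun x => g x ^ 2 * log (g x ^ 2)
    - (3 / 4 * T * M ^ 2 * (k * (x.1 - a)) ^ 2 + ν) * g x ^ 2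
    + σ * (1 - 2 * (1 - ρ)) * k * g x ^ 2
    - 4 * ρ * (1 - ρ) * σ * (pd1 g x ^ 2 + pd2 g x ^ 2) with hY
  have hG₁d : ∀ x, pd1 G₁ x = 2 * pd1 g x ^ 2 + 2 * g x * pd1 (pd1 g) x
      + (2 * k - pd1 u x) * g x ^ 2 + (2 * (k * (x.1 - a)) - u x) * (2 * g x * pd1 g x) := by
    intro x
    have a0 := hasDerivAt_pd1_s8 (dg x)
    have a1 := hasDerivAt_pd1_s8 (dg1 x)
    have a2 := hasDerivAt_pd1_s8 (du x)
    have a3 := (((hasDerivAt_id x.1).sub_const a).const_mul k).const_mul 2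
    have := ((a0.const_mul 2).fun_mul a1).fun_add ((a3.fun_sub a2).fun_mul (a0.fun_pow 2))
    refine (this.congr_deriv ?_).deriv
    simp; ring
  have hG₂d : ∀ x, pd2 G₂ x = 2 * pd2 g x ^ 2 + 2 * g x * pd2 (pd2 g) x
      - pd2 w x * g x ^ 2 - w x * (2 * g x * pd2 g x) := by
    intro x
    have a0 := hasDerivAt_pd2_s8 (dg x)
    have a1 := hasDerivAt_pd2_s8 (dg2 x)
    have a2 := hasDerivAt_pd2_s8 (dw x)
    have := ((a0.const_mul 2).fun_mul a1).fun_sub (a2.fun_mul (a0.fun_pow 2))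
    refine (this.congr_deriv ?_).deriv
    simp; ring
  have hG₁c : ContDiff ℝ 1 G₁ := by fun_prop
  have hG₂c : ContDiff ℝ 1 G₂ := by fun_prop
  have hper2 : ∀ x : ℝ × ℝ, pd2 g (x.1, x.2 + 1) = pd2 g x := by
    intro x
    have := (hasDerivAt_pd2_s8 (dg (x.1, x.2 + 1))).comp_add_const (x := x.2) (a := 1)
    have h2 : (fun y => g (x.1, y + 1)) = fun y => g (x.1, y) := funext fun y => hper (x.1, y)
    simp only [h2] at this
    exact this.unique (hasDerivAt_pd2_s8 (dg x))
  have hdiv0 : ∫ x in rect L, (pd1 G₁ x + pd2 G₂ x) = 0 := by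
    refine setIntegral_rect_divergence hL hG₁c hG₂c (fun x hx => ?_) fun x => ?_
    · simp [hG₁, hs x hx]
    · simp [hG₂, hper, hper2, hwper]
  have hid : ∀ x, energyDensity T M ρ a k ν u g w x =
      (Y x + σ * (1 - ρ) * (pd1 G₁ x + pd2 G₂ x)) + σ * -(k * (x.1 - a) * u x * g x ^ 2) := by
    intro x
    have := hdiv x
    rw [energyDensity, hG₁d, hG₂d, ← hσ]
    simp only [hY]
    linear_combination σ * (1 - ρ) * g x ^ 2 * this
  have cY : Continuous Y := by
    have := continuous_sq_mul_log_sq c0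
    fun_prop
  have cG : Continuous fun x => pd1 G₁ x + pd2 G₂ x :=
    (continuous_pd1_s8 hG₁c).add (continuous_pd2_s8 hG₂c)
  simp only [hid]
  rw [integral_add (integrableOn_rect (by fun_prop) L) (integrableOn_rect (by fun_prop) L),
    integral_add (integrableOn_rect (by fun_prop) L) (integrableOn_rect (by fun_prop) L),
    integral_const_mul, integral_const_mul, hdiv0, mul_zero, add_zero]
  have hdrift := integral_drift_le hL (c := fun y => k * (y - a)) hg1 c3 (by fun_prop) hM hmean
  have hfin : (∫ x in rect L, Y x) + σ * ∫ x in rect L, M * |k * (x.1 - a)| * |g x * pd2 g x| ≤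
      ∫ x in rect L, (g x ^ 2 * log (g x ^ 2) + ((σ * k - ν) * g x ^ 2
        + -(2 * ρ * (1 - ρ) * σ) * (pd1 g x ^ 2 + pd2 g x ^ 2))) := by
    have cl := continuous_sq_mul_log_sq c0
    rw [← integral_const_mul, ← integral_add (integrableOn_rect (by fun_prop) L)
      (integrableOn_rect (by fun_prop) L)]
    refine setIntegral_mono_on (integrableOn_rect (by fun_prop) L)
      (integrableOn_rect (by fun_prop) L) (measurableSet_rect L) fun x _ => ?_
    simp only [hY]
    rw [abs_mul (g x)]
    set b := |k * (x.1 - a)| with hb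
    have hb2 : (k * (x.1 - a)) ^ 2 = b ^ 2 := (sq_abs _).symm
    rw [hb2]
    have e1 : g x ^ 2 = |g x| ^ 2 := (sq_abs _).symm
    have e2 : pd2 g x ^ 2 = |pd2 g x| ^ 2 := (sq_abs _).symm
    have hamgm : σ * (M * b * (|g x| * |pd2 g x|)) ≤
        3 / 4 * T * M ^ 2 * b ^ 2 * g x ^ 2 + 2 * ρ * (1 - ρ) * σ * pd2 g x ^ 2 := by
      have hT3 : 0 ≤ T * (M * b * |g x| - 4 * ρ * (1 - ρ) * |pd2 g x|) ^ 2 := by positivity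
      rw [e1, e2, hσ]
      nlinarith
    have hk2 : σ * (1 - 2 * (1 - ρ)) * k * g x ^ 2 ≤ σ * k * g x ^ 2 := by
      have : 0 ≤ σ * (1 - ρ) * k * g x ^ 2 := by positivity
      nlinarith
    have : 0 ≤ 2 * ρ * (1 - ρ) * σ * pd1 g x ^ 2 := by positivity
    linarith
  have hls := integral_sq_mul_log_sq_le hL hg1 hs h1 hv hv1 hv2
  rw [integral_add (integrableOn_rect (continuous_sq_mul_log_sq c0) L)
    (integrableOn_rect (by fun_prop) L), integral_add (integrableOn_rect (by fun_prop) L)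
    (integrableOn_rect (by fun_prop) L), integral_const_mul, integral_const_mul, h1] at hfin
  have hε : 2 * ρ * (1 - ρ) * σ = 12 * T * ρ ^ 2 * (1 - ρ) ^ 2 := by rw [hσ]; ring
  rw [hε] at hfin
  rw [← hσ] at hν
  have := mul_le_mul_of_nonneg_left hdrift hσ0.le
  linarith

/-! ### The smoothed powers of the positive part -/

/-- The logarithm of the smoothed positive part. -/
def logProfile (κ r : ℝ) : ℝ := log (r + κ) - 2 * κ / r

/-- The power `c` of a smoothed positive part: `exp (c * logProfile κ r)` for `0 < r`, and `0` for
`r ≤ 0`. -/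
def profile (κ c r : ℝ) : ℝ := exp (c * log (r + κ)) * expNegInvGlue (r / (2 * κ * c))

lemma profile_nonneg (κ c r : ℝ) : 0 ≤ profile κ c r :=
  mul_nonneg (exp_pos _).le (expNegInvGlue.nonneg _)

lemma profile_of_nonpos {κ c r : ℝ} (hκ : 0 < κ) (hc : 0 < c) (hr : r ≤ 0) :
    profile κ c r = 0 := by
  rw [profile, expNegInvGlue.zero_of_nonpos (div_nonpos_of_nonpos_of_nonneg hr (by positivity)),
    mul_zero]

lemma profile_of_pos {κ c r : ℝ} (hκ : 0 < κ) (hc : 0 < c) (hr : 0 < r) :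
    profile κ c r = exp (c * logProfile κ r) := by
  have h : ¬ r / (2 * κ * c) ≤ 0 := not_le.2 (by positivity)
  rw [profile, logProfile, expNegInvGlue, if_neg h, ← exp_add]
  congr 1
  field_simp
  ring

lemma exp_logProfile_le {κ r : ℝ} (hκ : 0 < κ) (hr : 0 < r) : exp (logProfile κ r) ≤ r := by
  have h : (r + κ) / r ≤ exp (2 * κ / r) := by
    refine le_trans ?_ (add_one_le_exp _)
    rw [div_add_one hr.ne']
    exact div_le_div_of_nonneg_right (by linarith) hr.le
  rw [logProfile, exp_sub, exp_log (by positivity), div_le_iff₀ (exp_pos _)]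
  calc r + κ = r * ((r + κ) / r) := by field_simp
    _ ≤ _ := by gcongr

lemma profile_half_sq_le {κ : ℝ} (hκ : 0 < κ) (r : ℝ) : profile κ (1 / 2) r ^ 2 ≤ max r 0 := by
  rcases le_or_gt r 0 with hr | hr
  · rw [profile_of_nonpos hκ one_half_pos hr, zero_pow two_ne_zero]
    exact le_max_right _ _
  · rw [profile_of_pos hκ one_half_pos hr, ← exp_nat_mul]
    refine (le_of_eq ?_).trans ((exp_logProfile_le hκ hr).trans (le_max_left _ _))
    congr 1
    push_cast
    ring

lemma hasDerivAt_logProfile {κ r : ℝ} (hκ : 0 < κ) (hr : 0 < r) :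
    HasDerivAt (logProfile κ) (1 / (r + κ) + 2 * κ / r ^ 2) r := by
  have h1 : HasDerivAt (fun r => log (r + κ)) (1 / (r + κ)) r :=
    ((hasDerivAt_id r).add_const κ).log (by simp only [id]; positivity)
  have h2 := (hasDerivAt_inv hr.ne').const_mul (2 * κ)
  refine (h1.sub h2).congr_deriv ?_
  field_simp
  ring

lemma hasDerivAt_deriv_logProfile {κ r : ℝ} (hκ : 0 < κ) (hr : 0 < r) :
    HasDerivAt (fun r => 1 / (r + κ) + 2 * κ / r ^ 2)
      (-(1 / (r + κ) ^ 2) - 4 * κ / r ^ 3) r := by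
  have hrk : r + κ ≠ 0 := by positivity
  have h1 := ((hasDerivAt_id r).add_const κ).fun_inv (by simpa using hrk)
  have h2 := (((hasDerivAt_id r).fun_pow 2).fun_inv (by simp [hr.ne'])).const_mul (2 * κ)
  have h3 := h1.fun_add h2
  simp only [id, div_eq_mul_inv, one_mul] at h3 ⊢
  refine h3.congr_deriv ?_
  push_cast
  field_simp
  ring

lemma logProfile_deriv_sq_add_nonneg {κ r : ℝ} (hκ : 0 < κ) (hr : 0 < r) :
    0 ≤ (1 / (r + κ) + 2 * κ / r ^ 2) ^ 2 + (-(1 / (r + κ) ^ 2) - 4 * κ / r ^ 3) := by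
  have h : (1 / (r + κ) + 2 * κ / r ^ 2) ^ 2 + (-(1 / (r + κ) ^ 2) - 4 * κ / r ^ 3) =
      4 * κ ^ 3 / (r ^ 4 * (r + κ)) := by
    field_simp
    ring
  rw [h]
  positivity

lemma contDiffAt_profile {κ c r : ℝ} (hκ : 0 < κ) (hc : 0 < c) (n : ℕ) :
    ContDiffAt ℝ n (fun z : ℝ × ℝ => profile κ z.1 z.2) (c, r) := by
  rcases lt_or_ge r 0 with hr | hr
  · refine (contDiffAt_const (c := (0 : ℝ))).congr_of_eventuallyEq ?_
    have h1 : ∀ᶠ z : ℝ × ℝ in nhds (c, r), 0 < z.1 := continuousAt_fst.eventually_const_lt hc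
    have h2 : ∀ᶠ z : ℝ × ℝ in nhds (c, r), z.2 < 0 := continuousAt_snd.eventually_lt_const hr
    filter_upwards [h1, h2] with z hz1 hz2
    exact profile_of_nonpos hκ hz1 hz2.le
  · unfold profile
    have h1 : (r + κ) ≠ 0 := by positivity
    have h2 : 2 * κ * c ≠ 0 := by positivity
    refine ContDiffAt.mul (ContDiffAt.exp (contDiffAt_fst.mul
      ((contDiffAt_snd.add contDiffAt_const).log h1))) ?_
    exact expNegInvGlue.contDiff.contDiffAt.comp _
      (contDiffAt_snd.div (contDiffAt_const.mul contDiffAt_fst) h2)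

/-- The derivative of a weighted smoothed power along a curve where its base is positive. -/
lemma hasDerivAt_profile_mul_exp {κ : ℝ} (hκ : 0 < κ) {c q ψ : ℝ → ℝ} {c' q' ψ' y : ℝ}
    (hc0 : 0 < c y) (hq0 : 0 < q y)
    (hc : HasDerivAt c c' y) (hq : HasDerivAt q q' y) (hψ : HasDerivAt ψ ψ' y) :
    HasDerivAt (fun y => profile κ (c y) (q y) * exp (-(c y * ψ y)))
      (profile κ (c y) (q y) * exp (-(c y * ψ y)) * (c' * (logProfile κ (q y) - ψ y)
        + c y * ((1 / (q y + κ) + 2 * κ / q y ^ 2) * q' - ψ'))) y := by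
  have e : (fun y => profile κ (c y) (q y) * exp (-(c y * ψ y))) =ᶠ[nhds y]
      fun y => exp (c y * (logProfile κ (q y) - ψ y)) := by
    filter_upwards [hc.continuousAt.eventually_const_lt hc0,
      hq.continuousAt.eventually_const_lt hq0] with z hz1 hz2
    rw [profile_of_pos hκ hz1 hz2, ← exp_add]
    congr 1
    ring
  rw [e.eq_of_nhds]
  refine HasDerivAt.congr_of_eventuallyEq ?_ e
  exact (hc.fun_mul (((hasDerivAt_logProfile hκ hq0).comp y hq).fun_sub hψ)).exp

/-- The first two derivatives of a weighted smoothed power where its base is positive. -/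
lemma deriv_deriv_profile_mul_exp {κ c : ℝ} (hκ : 0 < κ) {q q' ψ ψ' : ℝ → ℝ} {q'' ψ'' y : ℝ}
    (hc0 : 0 < c) (hq0 : 0 < q y)
    (hq : ∀ y, HasDerivAt q (q' y) y) (hq' : HasDerivAt q' q'' y)
    (hψ : ∀ y, HasDerivAt ψ (ψ' y) y) (hψ' : HasDerivAt ψ' ψ'' y) :
    deriv (fun y => deriv (fun y => profile κ c (q y) * exp (-(c * ψ y))) y) y =
      profile κ c (q y) * exp (-(c * ψ y)) *
        (c * ((-(1 / (q y + κ) ^ 2) - 4 * κ / q y ^ 3) * q' y ^ 2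
          + (1 / (q y + κ) + 2 * κ / q y ^ 2) * q'' - ψ'')
          + (c * ((1 / (q y + κ) + 2 * κ / q y ^ 2) * q' y - ψ' y)) ^ 2) := by
  have h : ∀ y, 0 < q y → HasDerivAt (fun y => profile κ c (q y) * exp (-(c * ψ y)))
      (profile κ c (q y) * exp (-(c * ψ y)) *
        (c * ((1 / (q y + κ) + 2 * κ / q y ^ 2) * q' y - ψ' y))) y := fun y hy =>
    (hasDerivAt_profile_mul_exp hκ hc0 hy (hasDerivAt_const y c) (hq y) (hψ y)).congr_deriv
      (by ring)
  have e : (fun y => deriv (fun y => profile κ c (q y) * exp (-(c * ψ y))) y) =ᶠ[nhds y]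
      fun y => profile κ c (q y) * exp (-(c * ψ y)) *
        (c * ((1 / (q y + κ) + 2 * κ / q y ^ 2) * q' y - ψ' y)) := by
    filter_upwards [(hq y).continuousAt.eventually_const_lt hq0] with z hz
    exact (h z hz).deriv
  rw [e.deriv_eq]
  have h2 := ((hasDerivAt_deriv_logProfile hκ hq0).comp y (hq y)).fun_mul hq'
  refine (((h y hq0).fun_mul ((h2.fun_sub hψ').const_mul c)).congr_deriv ?_).deriv
  simp only [Function.comp_apply]
  ring

/-! ### The weight -/

/-- The time change `ρ ↦ T (3ρ² - 2ρ³)` of `[0, 1]` onto `[0, T]`. -/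
def timeChange (T ρ : ℝ) : ℝ := T * (3 * ρ ^ 2 - 2 * ρ ^ 3)

/-- The denominator of the Gaussian weight. -/
def weightScale (lam M T ρ : ℝ) : ℝ :=
  (1 + M ^ 2) * T / lam - timeChange T ρ - 3 / 4 * T * M ^ 2 * ρ

/-- The exponent gained between the initial and the final time, up to an absolute constant. -/
def gainExponent (lam T : ℝ) : ℝ := log (2 / (12 * Vmin T)) + 3 * lam / (4 * (1 - lam))

/-- The logarithm of the bound for the norm at parameter `ρ`. -/
def normExponent (lam T N ρ : ℝ) : ℝ :=
  log N + gainExponent lam T * ρ + 2 * negMulLog ρ - 2 * negMulLog (1 - ρ) + 4 * ρ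

/-- The exponent of the weight at parameter `ρ`. -/
def potential (lam M T a N ρ : ℝ) (x : ℝ × ℝ) : ℝ :=
  (x.1 - a) ^ 2 / (4 * weightScale lam M T ρ) + normExponent lam T N ρ

lemma hasDerivAt_timeChange (T ρ : ℝ) :
    HasDerivAt (timeChange T) (6 * T * ρ * (1 - ρ)) ρ := by
  have h := ((((hasDerivAt_id ρ).fun_pow 2).const_mul 3).fun_sub
    (((hasDerivAt_id ρ).fun_pow 3).const_mul 2)).const_mul T
  refine h.congr_deriv ?_
  simp only [id]
  push_cast
  ring

lemma timeChange_pos {T ρ : ℝ} (hT : 0 < T) (h0 : 0 < ρ) (h1 : ρ < 1) : 0 < timeChange T ρ := by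
  have : 3 * ρ ^ 2 - 2 * ρ ^ 3 = ρ ^ 2 * (3 - 2 * ρ) := by ring
  rw [timeChange, this]
  have : 0 < 3 - 2 * ρ := by linarith
  positivity

lemma timeChange_nonneg {T ρ : ℝ} (hT : 0 < T) (h1 : ρ ≤ 1) : 0 ≤ timeChange T ρ := by
  have : 3 * ρ ^ 2 - 2 * ρ ^ 3 = ρ ^ 2 * (3 - 2 * ρ) := by ring
  rw [timeChange, this]
  have : 0 < 3 - 2 * ρ := by linarith
  positivity

lemma timeChange_le {T ρ : ℝ} (hT : 0 < T) (h0 : 0 ≤ ρ) : timeChange T ρ ≤ T := by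
  rw [timeChange]
  have : 0 ≤ (1 - ρ) ^ 2 * (1 + 2 * ρ) := by positivity
  nlinarith

lemma le_weightScale {lam M T ρ : ℝ} (hlam : 0 < lam) (hT : 0 < T) (h0 : 0 ≤ ρ) (h1 : ρ ≤ 1) :
    T * ((1 - lam) / lam) + (1 - lam) / lam * (M ^ 2 * T) ≤ weightScale lam M T ρ := by
  have h2 := timeChange_le hT h0
  have h3 : T * M ^ 2 * ρ ≤ T * M ^ 2 := by nlinarith [mul_nonneg hT.le (sq_nonneg M)]
  have h4 : T * ((1 - lam) / lam) + (1 - lam) / lam * (M ^ 2 * T) =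
      (1 + M ^ 2) * T / lam - T - T * M ^ 2 := by
    field_simp
    ring
  rw [h4, weightScale]
  have h5 : 0 ≤ T * M ^ 2 * ρ := by positivity
  linarith

lemma weightScale_pos {lam M T ρ : ℝ} (hlam0 : 0 < lam) (hlam1 : lam < 1) (hT : 0 < T)
    (h0 : 0 ≤ ρ) (h1 : ρ ≤ 1) : 0 < weightScale lam M T ρ := by
  refine lt_of_lt_of_le ?_ (le_weightScale hlam0 hT h0 h1)
  have : 0 < 1 - lam := by linarith
  positivity

lemma hasDerivAt_normExponent {lam T N ρ : ℝ} (h0 : 0 < ρ) (h1 : ρ < 1) :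
    HasDerivAt (normExponent lam T N)
      (gainExponent lam T - 2 * log ρ - 2 * log (1 - ρ)) ρ := by
  have e1 := (hasDerivAt_id ρ).const_mul (gainExponent lam T)
  have e2 := (hasDerivAt_negMulLog h0.ne').const_mul 2
  have e3 := (((hasDerivAt_negMulLog (by linarith : (1 - ρ) ≠ 0)).comp ρ
    ((hasDerivAt_id ρ).const_sub 1))).const_mul 2
  have e4 := (hasDerivAt_id ρ).const_mul 4
  have := ((((e1.const_add (log N)).fun_add e2).fun_sub e3).fun_add e4)
  refine this.congr_deriv ?_
  simp
  ring

lemma continuous_normExponent (lam T N : ℝ) : Continuous (normExponent lam T N) := by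
  unfold normExponent
  have := continuous_negMulLog
  fun_prop

lemma normExponent_zero (lam T N : ℝ) : normExponent lam T N 0 = log N := by
  simp [normExponent]

lemma normExponent_one (lam T N : ℝ) :
    normExponent lam T N 1 = log N + gainExponent lam T + 4 := by
  simp [normExponent]

lemma hasDerivAt_potential {lam M T a N ρ : ℝ} {x : ℝ × ℝ} (hlam0 : 0 < lam) (hlam1 : lam < 1)
    (hT : 0 < T) (h0 : 0 < ρ) (h1 : ρ < 1) :
    HasDerivAt (fun ρ => potential lam M T a N ρ x)
      ((6 * T * ρ * (1 - ρ) + 3 / 4 * T * M ^ 2)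
        * (1 / (2 * weightScale lam M T ρ) * (x.1 - a)) ^ 2
        + (gainExponent lam T - 2 * log ρ - 2 * log (1 - ρ))) ρ := by
  have hR := weightScale_pos (M := M) hlam0 hlam1 hT h0.le h1.le
  have e1 : HasDerivAt (weightScale lam M T)
      (-(6 * T * ρ * (1 - ρ)) - 3 / 4 * T * M ^ 2) ρ := by
    refine (((hasDerivAt_timeChange T ρ).const_sub _).fun_sub
      ((hasDerivAt_id ρ).const_mul (3 / 4 * T * M ^ 2))).congr_deriv ?_
    ring
  have e2 := ((e1.const_mul 4).fun_inv (by positivity)).const_mul ((x.1 - a) ^ 2)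
  refine (e2.fun_add (hasDerivAt_normExponent (lam := lam) (T := T) (N := N) h0 h1)).congr_deriv ?_
  field_simp
  ring

lemma Vmin_pos {T : ℝ} (hT : 0 < T) : 0 < Vmin T := lt_min hT (Real.sqrt_pos.2 hT)

lemma exp_gainExponent {lam T : ℝ} (hT : 0 < T) :
    exp (gainExponent lam T + 4) = exp (4 + 3 * lam / (4 * (1 - lam))) / 6 / Vmin T := by
  have hV := Vmin_pos hT
  have : gainExponent lam T + 4 =
      log (2 / (12 * Vmin T)) + (4 + 3 * lam / (4 * (1 - lam))) := by
    rw [gainExponent]; ring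
  rw [this, exp_add, exp_log (by positivity)]
  field_simp
  norm_num

/-- The conditions under which `integral_energyDensity_neg` applies to the weight. -/
lemma exists_logSobolev_scale {lam M T ρ : ℝ} (hlam0 : 0 < lam) (hlam1 : lam < 1) (hT : 0 < T)
    (h0 : 0 < ρ) (h1 : ρ < 1) :
    ∃ v, 0 < v ∧ v ≤ 12 * T * ρ ^ 2 * (1 - ρ) ^ 2 ∧ v ^ 2 ≤ 12 * T * ρ ^ 2 * (1 - ρ) ^ 2 ∧
      log (2 / v) + 6 * T * ρ * (1 - ρ) * (1 / (2 * weightScale lam M T ρ)) ≤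
        gainExponent lam T - 2 * log ρ - 2 * log (1 - ρ) := by
  have hV := Vmin_pos hT
  have hr : 0 < 1 - ρ := by linarith
  have hR := weightScale_pos (M := M) hlam0 hlam1 hT h0.le h1.le
  have hV1 : Vmin T ≤ T := min_le_left _ _
  have hV2 : Vmin T ^ 2 ≤ T := by
    calc Vmin T ^ 2 ≤ Real.sqrt T ^ 2 := by gcongr; exact min_le_right _ _
      _ = T := Real.sq_sqrt hT.le
  have hρ : ρ * (1 - ρ) ≤ 1 / 4 := by nlinarith [sq_nonneg (ρ - 1 / 2)]
  have hρ2 : 12 * (ρ ^ 2 * (1 - ρ) ^ 2) ≤ 1 := by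
    have : 0 ≤ ρ * (1 - ρ) := by positivity
    nlinarith
  refine ⟨12 * ρ ^ 2 * (1 - ρ) ^ 2 * Vmin T, by positivity, ?_, ?_, ?_⟩
  · have : 12 * T * ρ ^ 2 * (1 - ρ) ^ 2 = 12 * ρ ^ 2 * (1 - ρ) ^ 2 * T := by ring
    rw [this]; gcongr
  · calc (12 * ρ ^ 2 * (1 - ρ) ^ 2 * Vmin T) ^ 2
        = (12 * (ρ ^ 2 * (1 - ρ) ^ 2)) * (12 * (ρ ^ 2 * (1 - ρ) ^ 2)) * Vmin T ^ 2 := by ring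
      _ ≤ 1 * (12 * (ρ ^ 2 * (1 - ρ) ^ 2)) * T := by gcongr
      _ = _ := by ring
  · have e1 : log (2 / (12 * ρ ^ 2 * (1 - ρ) ^ 2 * Vmin T)) =
        log (2 / (12 * Vmin T)) - 2 * log ρ - 2 * log (1 - ρ) := by
      have : 2 / (12 * ρ ^ 2 * (1 - ρ) ^ 2 * Vmin T) =
        2 / (12 * Vmin T) / ρ ^ 2 / (1 - ρ) ^ 2 := by field_simp
      rw [this, log_div (by positivity) (by positivity), log_div (by positivity) (by positivity),
        log_pow, log_pow]
      push_cast
      ring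
    have hl : 0 < 1 - lam := by linarith
    have e2 : 6 * T * ρ * (1 - ρ) * (1 / (2 * weightScale lam M T ρ)) ≤
        3 * lam / (4 * (1 - lam)) := by
      have h3 : T * ((1 - lam) / lam) ≤ weightScale lam M T ρ := by
        refine le_trans ?_ (le_weightScale hlam0 hT h0.le h1.le)
        have : 0 ≤ (1 - lam) / lam * (M ^ 2 * T) := by positivity
        linarith
      calc 6 * T * ρ * (1 - ρ) * (1 / (2 * weightScale lam M T ρ))
          = 6 * T * (ρ * (1 - ρ)) * (1 / (2 * weightScale lam M T ρ)) := by ring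
        _ ≤ 6 * T * (1 / 4) * (1 / (2 * (T * ((1 - lam) / lam)))) := by gcongr
        _ = _ := by field_simp; norm_num
    rw [e1, gainExponent]
    linarith

/-! ### Weighted powers of a subsolution -/

/-- A periodic subsolution of the advection-diffusion equation whose positive part is supported in
the strip `|x₁| < L`. -/
structure IsCutoffSubsolution (M L : ℝ) (u : ℝ → ℝ × ℝ → ℝ × ℝ) (q : ℝ → ℝ × ℝ → ℝ) : Prop where
  contDiff_fst : ∀ s, 0 < s → ContDiff ℝ 1 fun x => (u s x).1
  contDiff_snd : ∀ s, 0 < s → ContDiff ℝ 1 fun x => (u s x).2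
  velocity_periodic : ∀ s, 0 < s → ∀ x : ℝ × ℝ, u s (x.1, x.2 + 1) = u s x
  div_eq_zero : ∀ s, 0 < s → ∀ x, pd1 (fun y => (u s y).1) x + pd2 (fun y => (u s y).2) x = 0
  mean_eq_zero : ∀ s, 0 < s → ∀ x₁, ∫ x₂ in (0 : ℝ)..1, (u s (x₁, x₂)).1 = 0
  abs_fst_le : ∀ s, 0 < s → ∀ x, |(u s x).1| ≤ M
  continuousOn : ContinuousOn (fun z : ℝ × (ℝ × ℝ) => q z.1 z.2) {z | 0 ≤ z.1}
  contDiffOn : ContDiffOn ℝ 2 (fun z : ℝ × (ℝ × ℝ) => q z.1 z.2) {z | 0 < z.1}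
  periodic : ∀ s, 0 ≤ s → ∀ x : ℝ × ℝ, q s (x.1, x.2 + 1) = q s x
  nonpos : ∀ s, 0 ≤ s → ∀ x : ℝ × ℝ, L ≤ |x.1| → q s x ≤ 0
  deriv_le : ∀ s, 0 < s → ∀ x, deriv (fun s => q s x) s + (u s x).1 * pd1 (q s) x
    + (u s x).2 * pd2 (q s) x ≤ pd1 (pd1 (q s)) x + pd2 (pd2 (q s)) x

/-- The `p / 2`-th power, `p = 1 / (1 - ρ)`, of the weighted smoothed positive part of `q`. -/
def weightedPower (κ lam M T a N : ℝ) (q : ℝ → ℝ × ℝ → ℝ) (ρ : ℝ) (x : ℝ × ℝ) : ℝ :=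
  profile κ (1 / (2 * (1 - ρ))) (q (timeChange T ρ) x)
    * exp (-(1 / (2 * (1 - ρ)) * potential lam M T a N ρ x))

lemma weightedPower_nonneg (κ lam M T a N : ℝ) (q : ℝ → ℝ × ℝ → ℝ) (ρ : ℝ) (x : ℝ × ℝ) :
    0 ≤ weightedPower κ lam M T a N q ρ x :=
  mul_nonneg (profile_nonneg _ _ _) (exp_pos _).le

lemma weightedPower_of_nonpos {κ lam M T a N ρ : ℝ} {q : ℝ → ℝ × ℝ → ℝ} {x : ℝ × ℝ} (hκ : 0 < κ)
    (h1 : ρ < 1) (hq : q (timeChange T ρ) x ≤ 0) : weightedPower κ lam M T a N q ρ x = 0 := by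
  have hr : 0 < 1 - ρ := by linarith
  rw [weightedPower, profile_of_nonpos hκ (by positivity) hq, zero_mul]

lemma weightedPower_of_pos {κ lam M T a N ρ : ℝ} {q : ℝ → ℝ × ℝ → ℝ} {x : ℝ × ℝ} (hκ : 0 < κ)
    (h1 : ρ < 1) (hq : 0 < q (timeChange T ρ) x) : weightedPower κ lam M T a N q ρ x =
      exp (1 / (2 * (1 - ρ)) *
        (logProfile κ (q (timeChange T ρ) x) - potential lam M T a N ρ x)) := by
  have hr : 0 < 1 - ρ := by linarith
  rw [weightedPower, profile_of_pos hκ (by positivity) hq, ← exp_add]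
  congr 1
  ring

lemma IsCutoffSubsolution.contDiffAt_weightedPower {κ lam M L T a N ρ : ℝ}
    {u : ℝ → ℝ × ℝ → ℝ × ℝ} {q : ℝ → ℝ × ℝ → ℝ} (h : IsCutoffSubsolution M L u q) (hκ : 0 < κ)
    (hlam0 : 0 < lam) (hlam1 : lam < 1) (hT : 0 < T) (h0 : 0 < ρ) (h1 : ρ < 1) (x : ℝ × ℝ) :
    ContDiffAt ℝ 2 (fun z : ℝ × (ℝ × ℝ) => weightedPower κ lam M T a N q z.1 z.2) (ρ, x) := by
  have hr : 0 < 1 - ρ := by linarith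
  have hR := weightScale_pos (M := M) hlam0 hlam1 hT h0.le h1.le
  have hc : ContDiffAt ℝ 2 (fun z : ℝ × (ℝ × ℝ) => 1 / (2 * (1 - z.1))) (ρ, x) := by
    refine contDiffAt_const.div (by fun_prop) ?_
    simp only
    positivity
  have hq : ContDiffAt ℝ 2 (fun z : ℝ × (ℝ × ℝ) => q (timeChange T z.1) z.2) (ρ, x) := by
    have hs := timeChange_pos hT h0 h1
    have e : {z : ℝ × (ℝ × ℝ) | 0 < z.1} ∈ nhds (timeChange T ρ, x) :=
      (isOpen_lt continuous_const continuous_fst).mem_nhds hs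
    refine ContDiffAt.comp (ρ, x) (g := fun z : ℝ × (ℝ × ℝ) => q z.1 z.2)
      (f := fun z : ℝ × (ℝ × ℝ) => (timeChange T z.1, z.2)) (h.contDiffOn.contDiffAt e) ?_
    unfold timeChange
    fun_prop
  have hp : ContDiffAt ℝ 2 (fun z : ℝ × (ℝ × ℝ) => potential lam M T a N z.1 z.2) (ρ, x) := by
    have hR' : ContDiffAt ℝ 2 (fun z : ℝ × (ℝ × ℝ) =>
        (z.2.1 - a) ^ 2 / (4 * weightScale lam M T z.1)) (ρ, x) := by
      refine ContDiffAt.div (by fun_prop) (contDiffAt_const.mul ?_) (by positivity)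
      unfold weightScale timeChange
      fun_prop
    refine hR'.add ?_
    unfold normExponent negMulLog
    have e1 : ContDiffAt ℝ 2 (fun z : ℝ × (ℝ × ℝ) => log z.1) (ρ, x) :=
      contDiffAt_fst.log h0.ne'
    have e2 : ContDiffAt ℝ 2 (fun z : ℝ × (ℝ × ℝ) => log (1 - z.1)) (ρ, x) :=
      ContDiffAt.log (by fun_prop) hr.ne'
    fun_prop
  have hc0 : 0 < 1 / (2 * (1 - ρ)) := by positivity
  have hG := contDiffAt_profile (r := q (timeChange T ρ) x) hκ hc0 2
  refine ContDiffAt.mul ?_ (hc.mul hp).neg.exp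
  exact ContDiffAt.comp (ρ, x) (g := fun z : ℝ × ℝ => profile κ z.1 z.2)
    (f := fun z : ℝ × (ℝ × ℝ) => (1 / (2 * (1 - z.1)), q (timeChange T z.1) z.2)) hG
    (hc.prodMk hq)

lemma IsCutoffSubsolution.continuousOn_weightedPower {κ lam M L T a N : ℝ}
    {u : ℝ → ℝ × ℝ → ℝ × ℝ} {q : ℝ → ℝ × ℝ → ℝ} (h : IsCutoffSubsolution M L u q) (hκ : 0 < κ)
    (hlam0 : 0 < lam) (hlam1 : lam < 1) (hT : 0 < T) :
    ContinuousOn (fun z : ℝ × (ℝ × ℝ) => weightedPower κ lam M T a N q z.1 z.2)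
      (Set.Ico 0 1 ×ˢ Set.univ) := by
  have hr : ∀ z : ℝ × (ℝ × ℝ), z ∈ (Set.Ico (0 : ℝ) 1 ×ˢ (Set.univ : Set (ℝ × ℝ))) →
      0 < 1 - z.1 := fun z hz => by have := hz.1.2; linarith
  have hc : ContinuousOn (fun z : ℝ × (ℝ × ℝ) => 1 / (2 * (1 - z.1)))
      (Set.Ico 0 1 ×ˢ Set.univ) := by
    refine continuousOn_const.div (by fun_prop) fun z hz => ?_
    have := hr z hz
    positivity
  have hp : ContinuousOn (fun z : ℝ × (ℝ × ℝ) => potential lam M T a N z.1 z.2)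
      (Set.Ico 0 1 ×ˢ Set.univ) := by
    refine ContinuousOn.add ?_ ((continuous_normExponent lam T N).comp_continuousOn
      continuousOn_fst)
    refine ContinuousOn.div (by fun_prop) ?_ fun z hz => ?_
    · unfold weightScale timeChange
      fun_prop
    · have := weightScale_pos (M := M) hlam0 hlam1 hT hz.1.1 hz.1.2.le
      positivity
  have hq : ContinuousOn (fun z : ℝ × (ℝ × ℝ) => q (timeChange T z.1) z.2)
      (Set.Ico 0 1 ×ˢ Set.univ) := by
    refine h.continuousOn.comp (f := fun z : ℝ × (ℝ × ℝ) => (timeChange T z.1, z.2)) ?_ ?_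
    · unfold timeChange
      fun_prop
    · exact fun z hz => timeChange_nonneg hT hz.1.2.le
  refine ContinuousOn.mul (fun z hz => ?_) (hc.mul hp).neg.rexp
  have := hr z hz
  have hc0 : 0 < 1 / (2 * (1 - z.1)) := by positivity
  exact ContinuousAt.comp_continuousWithinAt (g := fun z : ℝ × ℝ => profile κ z.1 z.2)
    (f := fun z : ℝ × (ℝ × ℝ) => (1 / (2 * (1 - z.1)), q (timeChange T z.1) z.2))
    (contDiffAt_profile hκ hc0 0).continuousAt
    ((hc z hz).prodMk (hq z hz))

/-- The square of the weighted power is a subsolution of the equation with density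
`energyDensity`. -/
lemma IsCutoffSubsolution.deriv_sq_weightedPower_le {κ lam M L T a N ρ : ℝ}
    {u : ℝ → ℝ × ℝ → ℝ × ℝ} {q : ℝ → ℝ × ℝ → ℝ} (h : IsCutoffSubsolution M L u q) (hκ : 0 < κ)
    (hlam0 : 0 < lam) (hlam1 : lam < 1) (hT : 0 < T) (h0 : 0 < ρ) (h1 : ρ < 1) (x : ℝ × ℝ) :
    (1 - ρ) * deriv (fun ρ => weightedPower κ lam M T a N q ρ x ^ 2) ρ ≤
      energyDensity T M ρ a (1 / (2 * weightScale lam M T ρ))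
        (gainExponent lam T - 2 * log ρ - 2 * log (1 - ρ))
        (fun x => (u (timeChange T ρ) x).1) (weightedPower κ lam M T a N q ρ)
        (fun x => (u (timeChange T ρ) x).2) x := by
  have hr : 0 < 1 - ρ := by linarith
  have hc0 : 0 < 1 / (2 * (1 - ρ)) := by positivity
  have hs := timeChange_pos hT h0 h1
  have hR := weightScale_pos (M := M) hlam0 hlam1 hT h0.le h1.le
  have hg := (h.contDiffAt_weightedPower (N := N) (a := a) hκ hlam0 hlam1 hT h0 h1 x).differentiableAt
    two_ne_zero
  have hgρ : DifferentiableAt ℝ (fun ρ => weightedPower κ lam M T a N q ρ x) ρ :=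
    DifferentiableAt.comp ρ (g := fun z : ℝ × (ℝ × ℝ) => weightedPower κ lam M T a N q z.1 z.2)
      (f := fun ρ => (ρ, x)) hg (by fun_prop)
  have e0 : deriv (fun ρ => weightedPower κ lam M T a N q ρ x ^ 2) ρ =
      2 * weightedPower κ lam M T a N q ρ x *
        deriv (fun ρ => weightedPower κ lam M T a N q ρ x) ρ := by
    rw [(hgρ.hasDerivAt.fun_pow 2).deriv]
    push_cast
    ring
  rw [e0]
  rcases le_or_gt (q (timeChange T ρ) x) 0 with hq0 | hq0
  · have hz : weightedPower κ lam M T a N q ρ x = 0 := weightedPower_of_nonpos hκ h1 hq0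
    have z1 : pd1 (weightedPower κ lam M T a N q ρ) x = 0 := by
      refine IsLocalMin.deriv_eq_zero (Filter.Eventually.of_forall fun y => ?_)
      simp only [Prod.mk.eta, hz]
      exact weightedPower_nonneg ..
    have z2 : pd2 (weightedPower κ lam M T a N q ρ) x = 0 := by
      refine IsLocalMin.deriv_eq_zero (Filter.Eventually.of_forall fun y => ?_)
      simp only [Prod.mk.eta, hz]
      exact weightedPower_nonneg ..
    simp [energyDensity, hz, z1, z2]
  have hqs : ContDiff ℝ 2 (q (timeChange T ρ)) := by
    refine contDiff_iff_contDiffAt.2 fun y => ?_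
    have e : {z : ℝ × (ℝ × ℝ) | 0 < z.1} ∈ nhds (timeChange T ρ, y) :=
      (isOpen_lt continuous_const continuous_fst).mem_nhds hs
    exact ContDiffAt.comp y (g := fun z : ℝ × (ℝ × ℝ) => q z.1 z.2)
      (f := fun y => (timeChange T ρ, y)) (h.contDiffOn.contDiffAt e) (by fun_prop)
  have hqt : HasDerivAt (fun s => q s x) (deriv (fun s => q s x) (timeChange T ρ))
      (timeChange T ρ) := by
    have e : {z : ℝ × (ℝ × ℝ) | 0 < z.1} ∈ nhds (timeChange T ρ, x) :=
      (isOpen_lt continuous_const continuous_fst).mem_nhds hs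
    exact (DifferentiableAt.comp (timeChange T ρ) (g := fun z : ℝ × (ℝ × ℝ) => q z.1 z.2)
      (f := fun s => (s, x)) ((h.contDiffOn.contDiffAt e).differentiableAt two_ne_zero)
      (by fun_prop)).hasDerivAt
  have hq1 : ContDiff ℝ 1 (pd1 (q (timeChange T ρ))) := contDiff_pd1 (n := 1) (by norm_num; exact hqs)
  have hq2 : ContDiff ℝ 1 (pd2 (q (timeChange T ρ))) := contDiff_pd2 (n := 1) (by norm_num; exact hqs)
  have dq := hqs.differentiable two_ne_zero
  have dq1 := hq1.differentiable one_ne_zero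
  have dq2 := hq2.differentiable one_ne_zero
  obtain ⟨k, hk⟩ : ∃ k, k = 1 / (2 * weightScale lam M T ρ) := ⟨_, rfl⟩
  have ψ1 : ∀ y : ℝ × ℝ, HasDerivAt (fun s => potential lam M T a N ρ (s, y.2)) (k * (y.1 - a)) y.1 := by
    intro y
    refine (((((hasDerivAt_id y.1).sub_const a).fun_pow 2).div_const
      (4 * weightScale lam M T ρ)).add_const (normExponent lam T N ρ)).congr_deriv ?_
    rw [hk]
    simp only [id]
    push_cast
    field_simp
    ring
  have ψ11 : HasDerivAt (fun s => k * (s - a)) k x.1 :=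
    (((hasDerivAt_id x.1).sub_const a).const_mul k).congr_deriv (by ring)
  have ψ2 : ∀ y : ℝ × ℝ, HasDerivAt (fun s => potential lam M T a N ρ (y.1, s)) 0 y.2 :=
    fun y => hasDerivAt_const y.2 (potential lam M T a N ρ y)
  have hcρ : HasDerivAt (fun ρ : ℝ => 1 / (2 * (1 - ρ))) (1 / (2 * (1 - ρ) ^ 2)) ρ := by
    have := ((((hasDerivAt_id ρ).const_sub 1).const_mul 2).fun_inv (by simp only [id]; positivity))
    simp only [id, ← one_div] at this
    refine this.congr_deriv ?_
    field_simp
  have d0 : deriv (fun ρ => weightedPower κ lam M T a N q ρ x) ρ = _ :=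
    (hasDerivAt_profile_mul_exp hκ (c := fun ρ : ℝ => 1 / (2 * (1 - ρ)))
      (q := fun ρ => q (timeChange T ρ) x) (ψ := fun ρ => potential lam M T a N ρ x) hc0 hq0 hcρ
      (hqt.comp ρ (hasDerivAt_timeChange T ρ))
      (hasDerivAt_potential hlam0 hlam1 hT h0 h1)).deriv
  have d1 : pd1 (weightedPower κ lam M T a N q ρ) x = _ :=
    (hasDerivAt_profile_mul_exp hκ (c := fun _ : ℝ => 1 / (2 * (1 - ρ)))
      (q := fun s => q (timeChange T ρ) (s, x.2)) hc0 hq0 (hasDerivAt_const _ _)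
      (hasDerivAt_pd1_s8 (dq x)) (ψ1 x)).deriv
  have d2 : pd2 (weightedPower κ lam M T a N q ρ) x = _ :=
    (hasDerivAt_profile_mul_exp hκ (c := fun _ : ℝ => 1 / (2 * (1 - ρ)))
      (q := fun s => q (timeChange T ρ) (x.1, s)) hc0 hq0 (hasDerivAt_const _ _)
      (hasDerivAt_pd2_s8 (dq x)) (ψ2 x)).deriv
  have d11 : pd1 (pd1 (weightedPower κ lam M T a N q ρ)) x = _ :=
    deriv_deriv_profile_mul_exp hκ (q := fun s => q (timeChange T ρ) (s, x.2))
      (q' := fun s => pd1 (q (timeChange T ρ)) (s, x.2)) (ψ := fun s => potential lam M T a N ρ (s, x.2))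
      (ψ' := fun s => k * (s - a)) hc0 hq0
      (fun y => hasDerivAt_pd1_s8 (dq (y, x.2))) (hasDerivAt_pd1_s8 (dq1 x)) (fun y => ψ1 (y, x.2)) ψ11
  have d22 : pd2 (pd2 (weightedPower κ lam M T a N q ρ)) x = _ :=
    deriv_deriv_profile_mul_exp hκ (q := fun s => q (timeChange T ρ) (x.1, s))
      (q' := fun s => pd2 (q (timeChange T ρ)) (x.1, s)) (ψ := fun s => potential lam M T a N ρ (x.1, s))
      (ψ' := fun _ => 0) hc0 hq0
      (fun y => hasDerivAt_pd2_s8 (dq (x.1, y))) (hasDerivAt_pd2_s8 (dq2 x)) (fun y => ψ2 (x.1, y))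
      (hasDerivAt_const _ _)
  have hlog : log (weightedPower κ lam M T a N q ρ x ^ 2) =
      1 / (1 - ρ) * (logProfile κ (q (timeChange T ρ) x) - potential lam M T a N ρ x) := by
    rw [weightedPower_of_pos hκ h1 hq0, log_pow, log_exp]
    push_cast
    field_simp
  have hL1 : 0 ≤ 1 / (q (timeChange T ρ) x + κ) + 2 * κ / q (timeChange T ρ) x ^ 2 := by positivity
  have hL2 := logProfile_deriv_sq_add_nonneg hκ hq0
  have hle := h.deriv_le _ hs x
  simp only [Prod.mk.eta] at d0 d1 d2 d11 d22
  rw [energyDensity, hlog, d0, d1, d2, d11, d22, ← hk]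
  have hgdef : profile κ (1 / (2 * (1 - ρ))) (q (timeChange T ρ) x)
    * exp (-(1 / (2 * (1 - ρ)) * potential lam M T a N ρ x)) =
      weightedPower κ lam M T a N q ρ x := rfl
  rw [hgdef]
  generalize weightedPower κ lam M T a N q ρ x = g
  generalize 1 / (q (timeChange T ρ) x + κ) + 2 * κ / q (timeChange T ρ) x ^ 2 = A at *
  generalize -(1 / (q (timeChange T ρ) x + κ) ^ 2) - 4 * κ / q (timeChange T ρ) x ^ 3 = B at *
  generalize deriv (fun s => q s x) (timeChange T ρ) = qs at *
  generalize pd1 (pd1 (q (timeChange T ρ))) x = q11 at *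
  generalize pd2 (pd2 (q (timeChange T ρ))) x = q22 at *
  generalize pd1 (q (timeChange T ρ)) x = q1 at *
  generalize pd2 (q (timeChange T ρ)) x = q2 at *
  generalize (u (timeChange T ρ) x).1 = U at *
  generalize (u (timeChange T ρ) x).2 = W at *
  generalize logProfile κ (q (timeChange T ρ) x) - potential lam M T a N ρ x = l
  generalize gainExponent lam T - 2 * log ρ - 2 * log (1 - ρ) = ν
  have key : 0 ≤ g ^ 2 * (6 * T * ρ * (1 - ρ)) *
      (A * (q11 + q22 - (qs + U * q1 + W * q2)) + (A ^ 2 + B) * (q1 ^ 2 + q2 ^ 2)) := by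
    have : 0 ≤ q11 + q22 - (qs + U * q1 + W * q2) := by linarith
    positivity
  rw [← sub_nonneg]
  refine key.trans_eq ?_
  field_simp
  ring

/-! ### The norm of the weighted power stays bounded -/

lemma hasDerivAt_setIntegral_of_contDiffAt {F : ℝ → ℝ × ℝ → ℝ} {K : Set (ℝ × ℝ)}
    (hK : IsCompact K) {α β ρ₀ : ℝ} (hρ₀ : ρ₀ ∈ Set.Ioo α β)
    (hF : ∀ ρ ∈ Set.Ioo α β, ∀ x, ContDiffAt ℝ 1 (fun z : ℝ × (ℝ × ℝ) => F z.1 z.2) (ρ, x)) :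
    IntegrableOn (fun x => deriv (fun ρ => F ρ x) ρ₀) K ∧
      HasDerivAt (fun ρ => ∫ x in K, F ρ x) (∫ x in K, deriv (fun ρ => F ρ x) ρ₀) ρ₀ := by
  have hd : ∀ ρ ∈ Set.Ioo α β, ∀ x, HasDerivAt (fun ρ => F ρ x)
      (fderiv ℝ (fun z : ℝ × (ℝ × ℝ) => F z.1 z.2) (ρ, x) (1, 0)) ρ := fun ρ hρ x =>
    HasFDerivAt.comp_hasDerivAt ρ (f := fun ρ => (ρ, x))
      ((hF ρ hρ x).differentiableAt one_ne_zero).hasFDerivAt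
      ((hasDerivAt_id ρ).prodMk (hasDerivAt_const ρ x))
  have hslice : ∀ ρ ∈ Set.Ioo α β, Continuous (F ρ) := fun ρ hρ =>
    continuous_iff_continuousAt.2 fun x => ContinuousAt.comp
      (g := fun z : ℝ × (ℝ × ℝ) => F z.1 z.2) (f := fun x => (ρ, x))
      (hF ρ hρ x).continuousAt (by fun_prop)
  have hcd : ∀ ρ ∈ Set.Ioo α β, ∀ x, ContinuousAt (fun z : ℝ × (ℝ × ℝ) =>
      fderiv ℝ (fun z : ℝ × (ℝ × ℝ) => F z.1 z.2) z (1, 0)) (ρ, x) := fun ρ hρ x =>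
    ((hF ρ hρ x).fderiv_right (m := 0) (by norm_num)).continuousAt.clm_apply continuousAt_const
  obtain ⟨a, ha⟩ := exists_between hρ₀.1
  obtain ⟨b, hb⟩ := exists_between hρ₀.2
  have hsub : Set.Icc a b ⊆ Set.Ioo α β := Set.Icc_subset_Ioo ha.1 hb.2
  obtain ⟨C, hC⟩ := (isCompact_Icc.prod hK).exists_bound_of_continuousOn
    (f := fun z : ℝ × (ℝ × ℝ) => fderiv ℝ (fun z : ℝ × (ℝ × ℝ) => F z.1 z.2) z (1, 0))
    (s := Set.Icc a b ×ˢ K) fun z hz => (hcd z.1 (hsub hz.1) z.2).continuousWithinAt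
  have hcont : Continuous fun x => fderiv ℝ (fun z : ℝ × (ℝ × ℝ) => F z.1 z.2) (ρ₀, x) (1, 0) :=
    continuous_iff_continuousAt.2 fun x => ContinuousAt.comp
      (g := fun z : ℝ × (ℝ × ℝ) => fderiv ℝ (fun z : ℝ × (ℝ × ℝ) => F z.1 z.2) z (1, 0))
      (f := fun x => (ρ₀, x)) (hcd ρ₀ hρ₀ x) (by fun_prop)
  have main := hasDerivAt_integral_of_dominated_loc_of_deriv_le
    (μ := volume.restrict K) (bound := fun _ => C) (F := F) (x₀ := ρ₀)
    (F' := fun ρ x => fderiv ℝ (fun z : ℝ × (ℝ × ℝ) => F z.1 z.2) (ρ, x) (1, 0))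
    (Icc_mem_nhds ha.2 hb.1)
    (by
      filter_upwards [Icc_mem_nhds ha.2 hb.1] with ρ hρ
      exact (hslice ρ (hsub hρ)).aestronglyMeasurable)
    ((hslice ρ₀ hρ₀).continuousOn.integrableOn_compact hK)
    hcont.aestronglyMeasurable
    (by
      filter_upwards [ae_restrict_mem hK.measurableSet] with x hx ρ hρ
      exact hC (ρ, x) ⟨hρ, hx⟩)
    (integrableOn_const (hK.measure_lt_top.ne))
    (Filter.Eventually.of_forall fun x ρ hρ => hd ρ (hsub hρ) x)
  have e : (fun x => deriv (fun ρ => F ρ x) ρ₀) =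
      fun x => fderiv ℝ (fun z : ℝ × (ℝ × ℝ) => F z.1 z.2) (ρ₀, x) (1, 0) :=
    funext fun x => (hd ρ₀ hρ₀ x).deriv
  rw [e]
  exact main

lemma continuous_energyDensity {T M ρ a k ν : ℝ} {u w g : ℝ × ℝ → ℝ} (hg : ContDiff ℝ 2 g)
    (hu : Continuous u) (hw : Continuous w) : Continuous (energyDensity T M ρ a k ν u g w) := by
  have hg1 : ContDiff ℝ 1 g := hg.of_le one_le_two
  have c0 := hg1.continuous
  have c1 := continuous_pd1_s8 hg1
  have c2 := continuous_pd2_s8 hg1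
  have c11 := continuous_pd1_s8 (contDiff_pd1 (n := 1) (by norm_num; exact hg) : ContDiff ℝ 1 (pd1 g))
  have c22 := continuous_pd2_s8 (contDiff_pd2 (n := 1) (by norm_num; exact hg) : ContDiff ℝ 1 (pd2 g))
  have cl := continuous_sq_mul_log_sq c0
  unfold energyDensity
  fun_prop

lemma IsCutoffSubsolution.continuousOn_integral_sq {κ lam M L T a N : ℝ}
    {u : ℝ → ℝ × ℝ → ℝ × ℝ} {q : ℝ → ℝ × ℝ → ℝ} (h : IsCutoffSubsolution M L u q) (hκ : 0 < κ)
    (hlam0 : 0 < lam) (hlam1 : lam < 1) (hT : 0 < T) :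
    ContinuousOn (fun ρ => ∫ x in rect L, weightedPower κ lam M T a N q ρ x ^ 2) (Set.Ico 0 1) := by
  rw [continuousOn_iff_continuous_domRestrict]
  have hc := h.continuousOn_weightedPower (a := a) (N := N) hκ hlam0 hlam1 hT
  have : LocallyCompactSpace (Set.Ico (0 : ℝ) 1) :=
    (isLocallyClosed_Ico (a := (0 : ℝ)) (b := 1)).locallyCompactSpace
  refine continuous_parametric_integral_of_continuous (X := Set.Ico (0 : ℝ) 1)
    (f := fun ρ x => weightedPower κ lam M T a N q ρ x ^ 2) ?_ (isCompact_rect L)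
  refine Continuous.pow ?_ 2
  exact hc.comp_continuous (f := fun z : Set.Ico (0 : ℝ) 1 × (ℝ × ℝ) => ((z.1 : ℝ), z.2))
    (by fun_prop) fun z => ⟨z.1.2, trivial⟩

lemma IsCutoffSubsolution.integral_sq_le_one {κ lam M L T a N ρ : ℝ}
    {u : ℝ → ℝ × ℝ → ℝ × ℝ} {q : ℝ → ℝ × ℝ → ℝ} (h : IsCutoffSubsolution M L u q) (hκ : 0 < κ)
    (hlam0 : 0 < lam) (hlam1 : lam < 1) (hT : 0 < T) (hL : 0 ≤ L) (hN : 0 < N)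
    (hinit : ∫ x in rect L, exp (-(lam * (x.1 - a) ^ 2 / (4 * (1 + M ^ 2) * T))) * max (q 0 x) 0 < N)
    (h0 : 0 < ρ) (h1 : ρ < 1) :
    ∫ x in rect L, weightedPower κ lam M T a N q ρ x ^ 2 ≤ 1 := by
  have hcont := h.continuousOn_integral_sq (a := a) (N := N) hκ hlam0 hlam1 hT
  have hslice0 : Continuous (weightedPower κ lam M T a N q 0) :=
    (h.continuousOn_weightedPower (a := a) (N := N) hκ hlam0 hlam1 hT).comp_continuous
      (f := fun x => ((0 : ℝ), x)) (by fun_prop) fun x => ⟨by simp, trivial⟩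
  have hq0 : Continuous (q 0) := h.continuousOn.comp_continuous
    (f := fun x => ((0 : ℝ), x)) (by fun_prop) fun x => by simp
  have hstart : ∫ x in rect L, weightedPower κ lam M T a N q 0 x ^ 2 < 1 := by
    calc ∫ x in rect L, weightedPower κ lam M T a N q 0 x ^ 2
        ≤ ∫ x in rect L, exp (-(lam * (x.1 - a) ^ 2 / (4 * (1 + M ^ 2) * T)))
            * max (q 0 x) 0 * N⁻¹ := by
          refine setIntegral_mono_on (integrableOn_rect (by fun_prop) L)
            (integrableOn_rect (by fun_prop) L) (measurableSet_rect L) fun x _ => ?_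
          have e1 : timeChange T 0 = 0 := by simp [timeChange]
          have e2 : exp (-(1 / (2 * (1 - 0)) * potential lam M T a N 0 x)) ^ 2 =
              exp (-(lam * (x.1 - a) ^ 2 / (4 * (1 + M ^ 2) * T))) * N⁻¹ := by
            rw [← exp_nat_mul, ← exp_log (inv_pos.2 hN), ← exp_add, log_inv]
            congr 1
            rw [potential, normExponent_zero, weightScale, e1]
            push_cast
            field_simp
            ring
          rw [weightedPower, mul_pow, e2, e1]
          have e3 := profile_half_sq_le hκ (q 0 x)
          have e4 : (1 : ℝ) / (2 * (1 - 0)) = 1 / 2 := by norm_num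
          rw [e4]
          calc _ ≤ max (q 0 x) 0 *
                (exp (-(lam * (x.1 - a) ^ 2 / (4 * (1 + M ^ 2) * T))) * N⁻¹) := by gcongr
            _ = _ := by ring
      _ = (∫ x in rect L, exp (-(lam * (x.1 - a) ^ 2 / (4 * (1 + M ^ 2) * T)))
            * max (q 0 x) 0) * N⁻¹ := integral_mul_const _ _
      _ < N * N⁻¹ := by gcongr
      _ = 1 := mul_inv_cancel₀ hN.ne'
  obtain ⟨α, hα0, hαρ, hα⟩ : ∃ α, 0 < α ∧ α < ρ ∧
      ∫ x in rect L, weightedPower κ lam M T a N q α x ^ 2 < 1 := by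
    have c0 : ContinuousWithinAt (fun ρ => ∫ x in rect L, weightedPower κ lam M T a N q ρ x ^ 2)
        (Set.Ioo 0 1) 0 :=
      (hcont 0 ⟨le_rfl, one_pos⟩).mono Set.Ioo_subset_Ico_self
    have e1 := c0.eventually_lt_const hstart
    rw [nhdsWithin_Ioo_eq_nhdsGT one_pos] at e1
    obtain ⟨α, hα1, hα2⟩ := (e1.and (Ioo_mem_nhdsGT h0)).exists
    exact ⟨α, hα2.1, hα2.2, hα1⟩
  have hderiv : ∀ ρ ∈ Set.Ioo (0 : ℝ) 1,
      IntegrableOn (fun x => deriv (fun ρ => weightedPower κ lam M T a N q ρ x ^ 2) ρ) (rect L) ∧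
      HasDerivAt (fun ρ => ∫ x in rect L, weightedPower κ lam M T a N q ρ x ^ 2)
        (∫ x in rect L, deriv (fun ρ => weightedPower κ lam M T a N q ρ x ^ 2) ρ) ρ :=
    fun ρ hρ => hasDerivAt_setIntegral_of_contDiffAt
      (F := fun ρ x => weightedPower κ lam M T a N q ρ x ^ 2) (isCompact_rect L) hρ fun ρ hρ x =>
        ((h.contDiffAt_weightedPower hκ hlam0 hlam1 hT hρ.1 hρ.2 x).of_le one_le_two).pow 2
  refine image_le_of_deriv_right_lt_deriv_boundary'
    (f := fun ρ => ∫ x in rect L, weightedPower κ lam M T a N q ρ x ^ 2) (a := α) (b := ρ)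
    (B := fun _ => 1) (B' := fun _ => 0)
    (hcont.mono fun y hy => ⟨hα0.le.trans hy.1, hy.2.trans_lt h1⟩)
    (fun y hy => (hderiv y ⟨hα0.trans_le hy.1, hy.2.trans h1⟩).2.hasDerivWithinAt)
    hα.le continuousOn_const (fun y _ => hasDerivWithinAt_const _ _ _) ?_
    (Set.right_mem_Icc.2 hαρ.le)
  intro y hy hy1
  have hy0 : 0 < y := hα0.trans_le hy.1
  have hy2 : y < 1 := hy.2.trans h1
  have hr : 0 < 1 - y := by linarith
  have hs := timeChange_pos hT hy0 hy2
  have hR := weightScale_pos (M := M) hlam0 hlam1 hT hy0.le hy2.le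
  obtain ⟨v, hv, hv1, hv2, hν⟩ := exists_logSobolev_scale (M := M) hlam0 hlam1 hT hy0 hy2
  have hg : ContDiff ℝ 2 (weightedPower κ lam M T a N q y) :=
    contDiff_iff_contDiffAt.2 fun x => ContDiffAt.comp x
      (g := fun z : ℝ × (ℝ × ℝ) => weightedPower κ lam M T a N q z.1 z.2) (f := fun x => (y, x))
      (h.contDiffAt_weightedPower hκ hlam0 hlam1 hT hy0 hy2 x) (by fun_prop)
  have hneg := integral_energyDensity_neg (L := L) (T := T) (M := M) (ρ := y) (a := a)
    (k := 1 / (2 * weightScale lam M T y)) hL hT hy0 hy2 (by positivity) hg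
    (fun x => by simp only [weightedPower, potential, h.periodic _ hs.le x])
    (fun x hx => weightedPower_of_nonpos hκ hy2 (h.nonpos _ hs.le x hx)) hy1
    (h.contDiff_fst _ hs) (h.contDiff_snd _ hs)
    (fun x => by rw [h.velocity_periodic _ hs x]) (h.div_eq_zero _ hs) (h.mean_eq_zero _ hs)
    (h.abs_fst_le _ hs) hv hv1 hv2 hν
  have hle := setIntegral_mono_on ((hderiv y ⟨hy0, hy2⟩).1.const_mul (1 - y))
    (integrableOn_rect (continuous_energyDensity (T := T) (M := M) (ρ := y) (a := a)
      (k := 1 / (2 * weightScale lam M T y))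
      (ν := gainExponent lam T - 2 * log y - 2 * log (1 - y)) hg
      (h.contDiff_fst _ hs).continuous (h.contDiff_snd _ hs).continuous) L)
    (measurableSet_rect L)
    fun x _ => h.deriv_sq_weightedPower_le (a := a) (N := N) hκ hlam0 hlam1 hT hy0 hy2 x
  rw [integral_const_mul] at hle
  have := hle.trans_lt hneg
  exact (mul_neg_iff.1 this).elim (fun h => h.2) fun h => absurd h.1 (by linarith)

/-! ### The pointwise bound for subsolutions -/

lemma IsCutoffSubsolution.exp_logProfile_le {κ lam M L T N : ℝ}
    {u : ℝ → ℝ × ℝ → ℝ × ℝ} {q : ℝ → ℝ × ℝ → ℝ} {x : ℝ × ℝ} (h : IsCutoffSubsolution M L u q)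
    (hκ : 0 < κ) (hlam0 : 0 < lam) (hlam1 : lam < 1) (hT : 0 < T) (hL : 0 ≤ L) (hN : 0 < N)
    (hinit : ∫ y in rect L,
      exp (-(lam * (y.1 - x.1) ^ 2 / (4 * (1 + M ^ 2) * T))) * max (q 0 y) 0 < N)
    (hx : x.2 ∈ Set.Icc (0 : ℝ) 1) (hq : 0 < q T x) :
    exp (logProfile κ (q T x)) ≤ N * exp (gainExponent lam T + 4) := by
  have e1 : timeChange T 1 = T := by rw [timeChange]; ring
  by_contra! hlt
  have hpos : 0 < logProfile κ (q T x) - (log N + gainExponent lam T + 4) := by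
    rw [← exp_log hN, ← exp_add, exp_lt_exp] at hlt
    linarith
  obtain ⟨l, hl0, hl⟩ := exists_between hpos
  have cq : ContinuousAt (fun z : ℝ × (ℝ × ℝ) => q (timeChange T z.1) z.2) (1, x) := by
    have e : {z : ℝ × (ℝ × ℝ) | 0 ≤ z.1} ∈ nhds (timeChange T 1, x) := by
      rw [e1]
      exact Filter.mem_of_superset ((isOpen_lt continuous_const continuous_fst).mem_nhds
        (show (T, x) ∈ {z : ℝ × (ℝ × ℝ) | 0 < z.1} from hT)) fun z hz => (show 0 < z.1 from hz).le
    refine ContinuousAt.comp (g := fun z : ℝ × (ℝ × ℝ) => q z.1 z.2)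
      (f := fun z : ℝ × (ℝ × ℝ) => (timeChange T z.1, z.2)) (h.continuousOn.continuousAt e) ?_
    unfold timeChange
    fun_prop
  have cpot : ContinuousAt (fun z : ℝ × (ℝ × ℝ) => potential lam M T x.1 N z.1 z.2) (1, x) := by
    refine ContinuousAt.add (ContinuousAt.div (by fun_prop) ?_ ?_)
      ((continuous_normExponent lam T N).continuousAt.comp continuousAt_fst)
    · unfold weightScale timeChange
      fun_prop
    · have := weightScale_pos (M := M) hlam0 hlam1 hT zero_le_one le_rfl
      positivity
  have cD : ContinuousAt (fun z : ℝ × (ℝ × ℝ) => logProfile κ (q (timeChange T z.1) z.2)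
      - potential lam M T x.1 N z.1 z.2) (1, x) := by
    refine ContinuousAt.sub ?_ cpot
    refine ContinuousAt.comp (g := logProfile κ)
      (f := fun z : ℝ × (ℝ × ℝ) => q (timeChange T z.1) z.2) ?_ cq
    rw [e1]
    exact (hasDerivAt_logProfile hκ hq).continuousAt
  have hev1 := cD.eventually_const_lt (u := l) (by
    simp only [e1, potential, normExponent_one]
    simpa using hl)
  have hev2 := cq.eventually_const_lt (u := 0) (by simpa only [e1] using hq)
  have hev := hev1.and hev2
  rw [nhds_prod_eq, Filter.eventually_prod_iff] at hev
  obtain ⟨pa, hpa, pb, hpb, hab⟩ := hev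
  obtain ⟨W, hWpb, hWo, hxW⟩ := mem_nhds_iff.1 hpb
  set U : Set (ℝ × ℝ) := W ∩ (Set.univ ×ˢ Set.Ioo 0 1) with hU
  have hUo : IsOpen U := hWo.inter (isOpen_univ.prod isOpen_Ioo)
  have hUne : U.Nonempty := by
    have hcl : x ∈ closure ((Set.univ : Set ℝ) ×ˢ Set.Ioo (0 : ℝ) 1) := by
      rw [closure_prod_eq, closure_Ioo zero_ne_one, closure_univ]
      exact ⟨trivial, hx⟩
    exact mem_closure_iff.1 hcl W hWo hxW
  have hnear : ∀ ρ, pa ρ → 0 < ρ → ρ < 1 → ∀ y ∈ U,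
      exp (1 / (2 * (1 - ρ)) * l) ^ 2 ≤ weightedPower κ lam M T x.1 N q ρ y ^ 2 := by
    intro ρ hρ h0 h1 y hy
    have hr : 0 < 1 - ρ := by linarith
    obtain ⟨hy1, hy2⟩ := hab hρ (hWpb hy.1)
    rw [weightedPower_of_pos hκ h1 hy2]
    gcongr
  obtain ⟨ρ₁, hρ₁, hρ₁'⟩ : ∃ ρ, pa ρ ∧ ρ ∈ Set.Ioo (0 : ℝ) 1 :=
    ((hpa.filter_mono nhdsWithin_le_nhds).and (Ioo_mem_nhdsLT one_pos)).exists
  have hUrect : U ⊆ rect L := by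
    intro y hy
    have hy2 := (hab hρ₁ (hWpb hy.1)).2
    have hy1 : |y.1| < L := by
      by_contra! hc
      exact absurd hy2 (not_lt.2 (h.nonpos _ (timeChange_nonneg hT hρ₁'.2.le) y hc))
    rw [rect_eq_prod]
    exact ⟨abs_le.1 hy1.le, Set.Ioo_subset_Icc_self hy.2.2⟩
  have hUfin : volume U ≠ ⊤ :=
    ((measure_mono hUrect).trans_lt (isCompact_rect L).measure_lt_top).ne
  have hUpos : 0 < volume.real U := ENNReal.toReal_pos (hUo.measure_pos volume hUne).ne' hUfin
  have hsmall : ∀ᶠ ρ in nhds (1 : ℝ), 1 - ρ < l * volume.real U := by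
    have hc : ContinuousAt (fun ρ : ℝ => 1 - ρ) 1 := by fun_prop
    exact hc.eventually_lt_const (by simp only [sub_self]; positivity)
  obtain ⟨ρ, ⟨hρ, hρs⟩, h0, h1⟩ := (((hpa.and hsmall).filter_mono nhdsWithin_le_nhds).and
    (Ioo_mem_nhdsLT one_pos)).exists
  have hr : 0 < 1 - ρ := by linarith
  have hcont : Continuous (weightedPower κ lam M T x.1 N q ρ) :=
    (h.continuousOn_weightedPower (a := x.1) (N := N) hκ hlam0 hlam1 hT).comp_continuous
      (f := fun x => (ρ, x)) (by fun_prop) fun x => ⟨⟨h0.le, h1⟩, trivial⟩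
  have hint := integrableOn_rect (hcont.pow 2) L
  have hle := calc
    exp (1 / (2 * (1 - ρ)) * l) ^ 2 * volume.real U
        ≤ ∫ y in U, weightedPower κ lam M T x.1 N q ρ y ^ 2 :=
          setIntegral_ge_of_const_le_real hUo.measurableSet hUfin (hnear ρ hρ h0 h1)
            (hint.mono_set hUrect)
    _ ≤ ∫ y in rect L, weightedPower κ lam M T x.1 N q ρ y ^ 2 :=
          setIntegral_mono_set hint (Filter.Eventually.of_forall fun y => sq_nonneg _)
            hUrect.eventuallyLE
    _ ≤ 1 := h.integral_sq_le_one hκ hlam0 hlam1 hT hL hN hinit h0 h1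
  have hexp : l / (1 - ρ) ≤ exp (1 / (2 * (1 - ρ)) * l) ^ 2 := by
    have e : exp (1 / (2 * (1 - ρ)) * l) ^ 2 = exp (l / (1 - ρ)) := by
      rw [← exp_nat_mul]
      congr 1
      push_cast
      field_simp
    rw [e]
    linarith [add_one_le_exp (l / (1 - ρ))]
  have hbig : 1 < l / (1 - ρ) * volume.real U := by
    rw [div_mul_eq_mul_div, one_lt_div hr]
    exact hρs
  have := mul_le_mul_of_nonneg_right hexp hUpos.le
  linarith

lemma IsCutoffSubsolution.le {lam M L T N : ℝ}
    {u : ℝ → ℝ × ℝ → ℝ × ℝ} {q : ℝ → ℝ × ℝ → ℝ} (h : IsCutoffSubsolution M L u q)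
    (hlam0 : 0 < lam) (hlam1 : lam < 1) (hT : 0 < T) (hL : 0 ≤ L) (hN : 0 < N) (x : ℝ × ℝ)
    (hinit : ∫ y in rect L,
      exp (-(lam * (y.1 - x.1) ^ 2 / (4 * (1 + M ^ 2) * T))) * max (q 0 y) 0 < N) :
    q T x ≤ N * exp (gainExponent lam T + 4) := by
  have hper : Function.Periodic (fun y => q T (x.1, y)) 1 := fun y => h.periodic T hT.le (x.1, y)
  have hfract : q T x = q T (x.1, Int.fract x.2) := by
    have := hper.sub_int_mul_eq (x := x.2) ⌊x.2⌋
    simp only [mul_one] at this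
    exact this.symm
  rw [hfract]
  rcases le_or_gt (q T (x.1, Int.fract x.2)) 0 with hq | hq
  · exact hq.trans (by positivity)
  have hlim : Filter.Tendsto (fun κ => exp (logProfile κ (q T (x.1, Int.fract x.2))))
      (nhdsWithin 0 (Set.Ioi 0)) (nhds (q T (x.1, Int.fract x.2))) := by
    have hc : ContinuousAt (fun κ => exp (logProfile κ (q T (x.1, Int.fract x.2)))) 0 := by
      unfold logProfile
      refine ContinuousAt.rexp (ContinuousAt.sub (ContinuousAt.log (by fun_prop) ?_) (by fun_prop))
      rw [add_zero]
      exact hq.ne'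
    have e : exp (logProfile 0 (q T (x.1, Int.fract x.2))) = q T (x.1, Int.fract x.2) := by
      simp [logProfile, exp_log hq]
    have := hc.tendsto.mono_left (nhdsWithin_le_nhds (s := Set.Ioi 0))
    rwa [e] at this
  refine le_of_tendsto hlim ?_
  filter_upwards [self_mem_nhdsWithin] with κ hκ
  exact h.exp_logProfile_le hκ hlam0 hlam1 hT hL hN hinit
    ⟨Int.fract_nonneg _, (Int.fract_lt_one _).le⟩ hq

/-! ### Solutions with compactly supported initial data -/

/-- Subtracting a multiple of `exp ((1 + M) s) * cosh x₁` turns a bounded solution into a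
subsolution whose positive part is supported in a strip. -/
lemma isCutoffSubsolution_sub_cosh {M B δ c : ℝ} {u : ℝ → ℝ × ℝ → ℝ × ℝ} {ω : ℝ → ℝ × ℝ → ℝ}
    (hM : 0 ≤ M) (hδ : 0 < δ) (hc : |c| ≤ 1)
    (hu : ContDiffOn ℝ (⊤ : ℕ∞) (fun z : ℝ × (ℝ × ℝ) => u z.1 z.2) {z | 0 ≤ z.1})
    (huper : ∀ t : ℝ, 0 ≤ t → ∀ x : ℝ × ℝ, u t (x.1, x.2 + 1) = u t x)
    (hdiv : ∀ t : ℝ, 0 ≤ t → ∀ x : ℝ × ℝ,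
      pd1 (fun y => (u t y).1) x + pd2 (fun y => (u t y).2) x = 0)
    (hmean : ∀ t : ℝ, 0 ≤ t → ∀ x₁ : ℝ, (∫ x₂ in (0:ℝ)..1, (u t (x₁, x₂)).1) = 0)
    (huM : ∀ t : ℝ, 0 ≤ t → ∀ x : ℝ × ℝ, |(u t x).1| ≤ M)
    (hω : ContinuousOn (fun z : ℝ × (ℝ × ℝ) => ω z.1 z.2) {z | 0 ≤ z.1})
    (hωd : ContDiffOn ℝ (⊤ : ℕ∞) (fun z : ℝ × (ℝ × ℝ) => ω z.1 z.2) {z | 0 < z.1})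
    (hB : ∀ t : ℝ, 0 ≤ t → ∀ x : ℝ × ℝ, |ω t x| ≤ B)
    (hωper : ∀ t : ℝ, 0 ≤ t → ∀ x : ℝ × ℝ, ω t (x.1, x.2 + 1) = ω t x)
    (heq : ∀ t : ℝ, 0 < t → ∀ x : ℝ × ℝ,
      deriv (fun s => ω s x) t + (u t x).1 * pd1 (ω t) x + (u t x).2 * pd2 (ω t) x
        = pd1 (pd1 (ω t)) x + pd2 (pd2 (ω t)) x) :
    IsCutoffSubsolution M (2 * B / δ) u
      (fun s x => c * ω s x - δ * (exp ((1 + M) * s) * cosh x.1)) := by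
  have hnhds : ∀ s : ℝ, 0 < s → ∀ x : ℝ × ℝ, {z : ℝ × (ℝ × ℝ) | 0 < z.1} ∈ nhds (s, x) :=
    fun s hs x => (isOpen_lt continuous_const continuous_fst).mem_nhds hs
  have huc : ∀ s : ℝ, 0 < s → ContDiff ℝ 1 (u s) := fun s hs =>
    contDiff_iff_contDiffAt.2 fun x => ContDiffAt.comp x
      (g := fun z : ℝ × (ℝ × ℝ) => u z.1 z.2) (f := fun x => (s, x))
      ((hu.contDiffAt (Filter.mem_of_superset (hnhds s hs x)
        fun z hz => (show 0 < z.1 from hz).le)).of_le (by exact_mod_cast le_top)) (by fun_prop)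
  refine ⟨fun s hs => (huc s hs).fst, fun s hs => (huc s hs).snd, fun s hs => huper s hs.le,
    fun s hs => hdiv s hs.le, fun s hs => hmean s hs.le, fun s hs => huM s hs.le, ?_, ?_, ?_, ?_, ?_⟩
  · have : Continuous fun z : ℝ × (ℝ × ℝ) => δ * (exp ((1 + M) * z.1) * cosh z.2.1) := by
      have := continuous_cosh
      fun_prop
    exact (hω.const_mul c).sub this.continuousOn
  · have : ContDiff ℝ 2 fun z : ℝ × (ℝ × ℝ) => δ * (exp ((1 + M) * z.1) * cosh z.2.1) := by
      have := contDiff_cosh (n := 2)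
      fun_prop
    exact (contDiffOn_const.mul (hωd.of_le (WithTop.coe_le_coe.2 (le_top (a := (2 : ℕ∞)))))).sub this.contDiffOn
  · intro s hs x
    simp only [hωper s hs x]
  · intro s hs x hx
    have e1 : c * ω s x ≤ B := by
      refine (le_abs_self _).trans ?_
      rw [abs_mul]
      have := hB s hs x
      nlinarith [abs_nonneg (ω s x), abs_nonneg c]
    have e2 : |x.1| / 2 ≤ cosh x.1 := by
      rw [← cosh_abs, cosh_eq]
      linarith [add_one_le_exp |x.1|, exp_pos (-|x.1|)]
    have e3 : 1 ≤ exp ((1 + M) * s) := one_le_exp (by positivity)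
    have e4 : B ≤ δ * cosh x.1 := by
      have : B / δ ≤ cosh x.1 := by
        refine le_trans ?_ e2
        rw [mul_div_assoc] at hx
        linarith
      rw [div_le_iff₀ hδ] at this
      linarith
    have e5 : cosh x.1 ≤ exp ((1 + M) * s) * cosh x.1 :=
      le_mul_of_one_le_left (cosh_pos _).le e3
    have := mul_le_mul_of_nonneg_left e5 hδ.le
    linarith
  · intro s hs x
    have hωs : ContDiff ℝ 2 (ω s) := contDiff_iff_contDiffAt.2 fun y => ContDiffAt.comp y
      (g := fun z : ℝ × (ℝ × ℝ) => ω z.1 z.2) (f := fun y => (s, y))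
      ((hωd.contDiffAt (hnhds s hs y)).of_le
        (WithTop.coe_le_coe.2 (le_top (a := (2 : ℕ∞))))) (by fun_prop)
    have dω := hωs.differentiable two_ne_zero
    have dω1 := (contDiff_pd1 (n := 1) (by norm_num; exact hωs)).differentiable one_ne_zero
    have dω2 := (contDiff_pd2 (n := 1) (by norm_num; exact hωs)).differentiable one_ne_zero
    have dt : HasDerivAt (fun s => ω s x) (deriv (fun s => ω s x) s) s :=
      (DifferentiableAt.comp s (g := fun z : ℝ × (ℝ × ℝ) => ω z.1 z.2) (f := fun s => (s, x))
        ((hωd.contDiffAt (hnhds s hs x)).differentiableAt (by simp)) (by fun_prop)).hasDerivAt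
    have t0 : deriv (fun s => c * ω s x - δ * (exp ((1 + M) * s) * cosh x.1)) s =
        c * deriv (fun s => ω s x) s - δ * ((1 + M) * exp ((1 + M) * s) * cosh x.1) := by
      have := (((hasDerivAt_id s).const_mul (1 + M)).exp.mul_const (cosh x.1)).const_mul δ
      refine (((dt.const_mul c).fun_sub this).congr_deriv ?_).deriv
      simp only [id]
      ring
    have t1 : ∀ x, pd1 (fun x => c * ω s x - δ * (exp ((1 + M) * s) * cosh x.1)) x =
        c * pd1 (ω s) x - δ * (exp ((1 + M) * s) * sinh x.1) := fun x =>
      (((hasDerivAt_pd1_s8 (dω x)).const_mul c).fun_sub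
        (((hasDerivAt_cosh x.1).const_mul _).const_mul δ)).deriv
    have t2 : ∀ x, pd2 (fun x => c * ω s x - δ * (exp ((1 + M) * s) * cosh x.1)) x =
        c * pd2 (ω s) x := fun x => (((hasDerivAt_pd2_s8 (dω x)).const_mul c).sub_const
        (δ * (exp ((1 + M) * s) * cosh x.1))).deriv
    have t11 : pd1 (pd1 (fun x => c * ω s x - δ * (exp ((1 + M) * s) * cosh x.1))) x =
        c * pd1 (pd1 (ω s)) x - δ * (exp ((1 + M) * s) * cosh x.1) := by
      rw [funext t1]
      exact (((hasDerivAt_pd1_s8 (dω1 x)).const_mul c).fun_sub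
        (((hasDerivAt_sinh x.1).const_mul _).const_mul δ)).deriv
    have t22 : pd2 (pd2 (fun x => c * ω s x - δ * (exp ((1 + M) * s) * cosh x.1))) x =
        c * pd2 (pd2 (ω s)) x := by
      rw [funext t2]
      exact ((hasDerivAt_pd2_s8 (dω2 x)).const_mul c).deriv
    rw [t0, t1, t2, t11, t22]
    have hsinh : -(u s x).1 * sinh x.1 ≤ M * cosh x.1 := by
      refine (le_abs_self _).trans ?_
      rw [abs_mul, abs_neg]
      refine mul_le_mul (huM s hs.le x) ?_ (abs_nonneg _) hM
      refine abs_le_of_sq_le_sq ?_ (cosh_pos _).le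
      rw [cosh_sq]
      linarith
    have hpos : 0 ≤ δ * exp ((1 + M) * s) * (M * cosh x.1 - -(u s x).1 * sinh x.1) :=
      mul_nonneg (by positivity) (by linarith)
    have := heq s hs x
    linear_combination c * this + hpos

lemma setIntegral_rect_le_integral_μΩ {f : ℝ × ℝ → ℝ} {R : ℝ} (hf : Continuous f)
    (hf0 : ∀ x, 0 ≤ f x) (hR : ∀ x : ℝ × ℝ, R < |x.1| → f x = 0) (L : ℝ) :
    ∫ x in rect L, f x ≤ ∫ x, f x ∂μΩ := by
  have hae : (Set.univ ×ˢ Set.Ico (0 : ℝ) 1 : Set (ℝ × ℝ)) =ᵐ[volume]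
      Set.univ ×ˢ Set.Icc (0 : ℝ) 1 :=
    Measure.set_prod_ae_eq (Filter.EventuallyEq.refl _ _) Ico_ae_eq_Icc
  rw [μΩ, Measure.restrict_congr_set hae]
  have hint : IntegrableOn f (Set.univ ×ˢ Set.Icc (0 : ℝ) 1) := by
    refine (integrableOn_rect hf R).of_forall_sdiff_eq_zero
      (MeasurableSet.univ.prod measurableSet_Icc) fun x hx => hR x ?_
    by_contra! hc
    refine hx.2 ?_
    rw [rect_eq_prod]
    exact ⟨abs_le.1 hc, hx.1.2⟩
  refine setIntegral_mono_set hint (Filter.Eventually.of_forall hf0)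
    (Filter.Eventually.of_forall fun x hx => ?_)
  change x ∈ rect L at hx
  rw [rect_eq_prod] at hx
  exact ⟨trivial, hx.2⟩

/-- Gaussian upper bound for the advection-diffusion equation on the cylinder:
if `u` is divergence-free, `⟨u₁⟩ = 0` and `sup_t ‖u₁(t)‖_∞ ≤ M`, then for `λ ∈ (0,1)`
there is `K₂ > 0` independent of `u` with
`|ω(x,t)| ≤ (K₂/V(t)) ∫_Ω exp(-λ|x₁-y₁|²/(4(1+M²)t)) |ω₀(y)| dy`. -/
theorem gaussian_upper_bound (lam : ℝ) (hlam0 : 0 < lam) (hlam1 : lam < 1) :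
    ∃ K₂ > (0:ℝ), ∀ M : ℝ, 0 ≤ M →
      ∀ (u : ℝ → ℝ × ℝ → ℝ × ℝ) (ω : ℝ → ℝ × ℝ → ℝ) (ω₀ : ℝ × ℝ → ℝ),
      -- u is a smooth, periodic, divergence-free vector field on Ω × [0,∞)
      ContDiffOn ℝ (⊤ : ℕ∞) (fun z : ℝ × (ℝ × ℝ) => u z.1 z.2) {z | 0 ≤ z.1} →
      (∀ t : ℝ, 0 ≤ t → ∀ x : ℝ × ℝ, u t (x.1, x.2 + 1) = u t x) →
      (∀ t : ℝ, 0 ≤ t → ∀ x : ℝ × ℝ,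
        pd1 (fun y => (u t y).1) x + pd2 (fun y => (u t y).2) x = 0) →
      -- the first component has zero vertical average and is bounded by M
      (∀ t : ℝ, 0 ≤ t → ∀ x₁ : ℝ, (∫ x₂ in (0:ℝ)..1, (u t (x₁, x₂)).1) = 0) →
      (∀ t : ℝ, 0 ≤ t → ∀ x : ℝ × ℝ, |(u t x).1| ≤ M) →
      -- ω is a smooth bounded periodic solution of the advection-diffusion equation
      ContinuousOn (fun z : ℝ × (ℝ × ℝ) => ω z.1 z.2) {z | 0 ≤ z.1} →
      ContDiffOn ℝ (⊤ : ℕ∞) (fun z : ℝ × (ℝ × ℝ) => ω z.1 z.2) {z | 0 < z.1} →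
      (∃ B : ℝ, ∀ t : ℝ, 0 ≤ t → ∀ x : ℝ × ℝ, |ω t x| ≤ B) →
      (∀ t : ℝ, 0 ≤ t → ∀ x : ℝ × ℝ, ω t (x.1, x.2 + 1) = ω t x) →
      (∀ t : ℝ, 0 < t → ∀ x : ℝ × ℝ,
        deriv (fun s => ω s x) t + (u t x).1 * pd1 (ω t) x + (u t x).2 * pd2 (ω t) x
          = pd1 (pd1 (ω t)) x + pd2 (pd2 (ω t)) x) →
      -- the initial data is continuous, periodic and compactly supported in x₁
      ω 0 = ω₀ →
      Continuous ω₀ →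
      (∀ x : ℝ × ℝ, ω₀ (x.1, x.2 + 1) = ω₀ x) →
      (∃ R : ℝ, ∀ x : ℝ × ℝ, R < |x.1| → ω₀ x = 0) →
      ∀ t : ℝ, 0 < t → ∀ x : ℝ × ℝ,
        |ω t x| ≤ K₂ / Vmin t *
          ∫ y, Real.exp (-(lam * (x.1 - y.1) ^ 2) / (4 * (1 + M ^ 2) * t)) * |ω₀ y| ∂μΩ := by
  refine ⟨exp (4 + 3 * lam / (4 * (1 - lam))) / 6, by positivity, ?_⟩
  intro M hM u ω ω₀ hu huper hdiv hmean huM hω hωd ⟨B, hB⟩ hωper heq hω0 hω₀ _ ⟨R, hR⟩ T hT x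
  have hB0 : 0 ≤ B := (abs_nonneg _).trans (hB 0 le_rfl x)
  set I := ∫ y, exp (-(lam * (x.1 - y.1) ^ 2) / (4 * (1 + M ^ 2) * T)) * |ω₀ y| ∂μΩ with hI
  have hI0 : 0 ≤ I := integral_nonneg fun y => by positivity
  rw [← exp_gainExponent hT]
  have key : ∀ c : ℝ, |c| ≤ 1 → c * ω T x ≤ exp (gainExponent lam T + 4) * I := by
    intro c hc
    have hδ : ∀ δ, 0 < δ → c * ω T x ≤ exp (gainExponent lam T + 4) * I
        + δ * (exp ((1 + M) * T) * cosh x.1 + exp (gainExponent lam T + 4)) := by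
      intro δ hδ
      have h := isCutoffSubsolution_sub_cosh hM hδ hc hu huper hdiv hmean huM hω hωd hB hωper heq
      have hinit : ∫ y in rect (2 * B / δ),
          exp (-(lam * (y.1 - x.1) ^ 2 / (4 * (1 + M ^ 2) * T)))
            * max (c * ω 0 y - δ * (exp ((1 + M) * 0) * cosh y.1)) 0 < I + δ := by
        refine lt_of_le_of_lt ?_ (lt_add_of_pos_right I hδ)
        refine le_trans ?_ (setIntegral_rect_le_integral_μΩ
          (f := fun y => exp (-(lam * (x.1 - y.1) ^ 2) / (4 * (1 + M ^ 2) * T)) * |ω₀ y|) (R := R)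
          (by fun_prop) (fun y => by positivity)
          (fun y hy => by simp only [hR y hy, abs_zero, mul_zero]) (2 * B / δ))
        have := continuous_cosh
        rw [hω0]
        refine setIntegral_mono_on (integrableOn_rect (by fun_prop) _)
          (integrableOn_rect (by fun_prop) _) (measurableSet_rect _) fun y _ => ?_
        have e : -(lam * (y.1 - x.1) ^ 2 / (4 * (1 + M ^ 2) * T)) =
            -(lam * (x.1 - y.1) ^ 2) / (4 * (1 + M ^ 2) * T) := by ring
        rw [e]
        refine mul_le_mul_of_nonneg_left (max_le ?_ (abs_nonneg _)) (exp_pos _).le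
        have e1 : c * ω₀ y ≤ |ω₀ y| := by
          refine (le_abs_self _).trans ?_
          rw [abs_mul]
          exact mul_le_of_le_one_left (abs_nonneg _) hc
        have e2 : 0 ≤ δ * (exp ((1 + M) * 0) * cosh y.1) :=
          mul_nonneg hδ.le (mul_nonneg (exp_pos _).le (cosh_pos _).le)
        linarith
      have := h.le hlam0 hlam1 hT (by positivity) (by positivity) x hinit
      linarith
    have hlim : Filter.Tendsto (fun δ => exp (gainExponent lam T + 4) * I
        + δ * (exp ((1 + M) * T) * cosh x.1 + exp (gainExponent lam T + 4)))
        (nhdsWithin 0 (Set.Ioi 0)) (nhds (exp (gainExponent lam T + 4) * I)) := by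
      have hcont : Continuous fun δ => exp (gainExponent lam T + 4) * I
        + δ * (exp ((1 + M) * T) * cosh x.1 + exp (gainExponent lam T + 4)) := by fun_prop
      simpa using (hcont.tendsto 0).mono_left (nhdsWithin_le_nhds (s := Set.Ioi 0))
    refine ge_of_tendsto hlim ?_
    filter_upwards [self_mem_nhdsWithin] with δ hδ0
    exact hδ δ hδ0
  have k1 := key 1 (by simp)
  have k2 := key (-1) (by simp)
  exact abs_le.2 ⟨by linarith, by linarith⟩

end NS
end
end

section
/- (Iteration lemma) Let C > 0, M ≥ 0, α ∈ ℝ, and let S = {2^k : k ∈ ℕ, k ≥ 1}. Suppose that for each p ∈ {1} ∪ S, w_p : [0,∞) → (0,∞) is a differentiable function, and that for every p ∈ {1} ∪ S and every t > 0 the differential inequality w_{2p}'(t) ≤ −(C/(2p)) · min{ (w_{2p}(t)/w_p(t))^{2p} , (w_{2p}(t)/w_p(t))^{4p} } · w_{2p}(t) + α²(1 + (p/2)M²) w_{2p}(t) holds. Then for every ε > 0 there exists a constant C_ε > 0, depending only on ε and C, such that w_p(t) ≤ C_ε e^{(1+ε)α²(1+M²)t} V(t)^{−(p−2)/(2p)}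 w₂(0) for all t > 0 and all p ∈ S. -/
noncomputable section

namespace NS

lemma Vmin_pos_s9 {t : ℝ} (ht : 0 < t) : 0 < Vmin t :=
  lt_min ht (Real.sqrt_pos.2 ht)

lemma mul_Vmin_le {c t s : ℝ} (hc : 0 ≤ c) (hc1 : c ≤ 1) (ht : 0 ≤ t) (hs : c * t ≤ s) :
    c * Vmin t ≤ Vmin s := by
  have hs0 : 0 ≤ s := le_trans (by positivity) hs
  refine le_min ?_ ?_
  · exact (mul_le_mul_of_nonneg_left (min_le_left _ _) hc).trans hs
  · refine (mul_le_mul_of_nonneg_left (min_le_right _ _) hc).trans ?_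
    apply Real.le_sqrt_of_sq_le
    rw [mul_pow, Real.sq_sqrt ht]
    nlinarith [mul_nonneg (mul_nonneg hc ht) (sub_nonneg.2 hc1)]

/-- A superlinearly damped positive function is bounded independently of its initial value. -/
lemma min_pow_mul_le_one {C s T : ℝ} {n : ℕ} (hC : 0 < C) (hn : 0 < n) (hsT : s ≤ T)
    {r r' : ℝ → ℝ} (hr : ∀ t ∈ Set.Icc s T, 0 < r t)
    (hd : ∀ t ∈ Set.Icc s T, HasDerivAt r (r' t) t)
    (hle : ∀ t ∈ Set.Icc s T, r' t ≤ -(C / n) * min (r t ^ n) (r t ^ (2 * n)) * r t) :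
    min (r T ^ n) (r T ^ (2 * n)) * (C * (T - s)) ≤ 1 := by
  have hn0 : (0 : ℝ) < n := by exact_mod_cast hn
  have hTmem : T ∈ Set.Icc s T := Set.right_mem_Icc.2 hsT
  have hcont : ContinuousOn r (Set.Icc s T) := fun t ht =>
    (hd t ht).continuousAt.continuousWithinAt
  have hanti : AntitoneOn r (Set.Icc s T) := by
    refine antitoneOn_of_hasDerivWithinAt_nonpos (f' := r') (convex_Icc s T) hcont
      (fun t ht => (hd t (interior_subset ht)).hasDerivWithinAt) (fun t ht => ?_)
    have ht' := interior_subset ht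
    have h0 := hr t ht'
    have h1 : 0 < C / n * min (r t ^ n) (r t ^ (2 * n)) * r t := by positivity
    linarith [hle t ht']
  set m : ℝ := min 1 (r T ^ n) with hm
  have hrT := hr T hTmem
  have hm0 : 0 < m := lt_min one_pos (pow_pos hrT n)
  have hlow : ∀ t ∈ Set.Icc s T, m * r t ^ n ≤ min (r t ^ n) (r t ^ (2 * n)) := by
    intro t ht
    have h0 := pow_pos (hr t ht) n
    have hmt : m ≤ r t ^ n := (min_le_right _ _).trans
      (pow_le_pow_left₀ hrT.le (hanti ht hTmem ht.2) n)
    refine le_min ?_ ?_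
    · exact mul_le_of_le_one_left h0.le (min_le_left _ _)
    · rw [two_mul, pow_add]
      exact mul_le_mul_of_nonneg_right hmt h0.le
  have hder : ∀ t ∈ Set.Icc s T, HasDerivAt (fun t => (r t ^ n)⁻¹ - C * m * t)
      (-(n * r t ^ (n - 1) * r' t) / (r t ^ n) ^ 2 - C * m) t := by
    intro t ht
    have h := (((hd t ht).pow n).inv (pow_pos (hr t ht) n).ne').sub
      ((hasDerivAt_id t).const_mul (C * m))
    refine h.congr_deriv ?_
    rw [mul_one, Pi.pow_apply]
  have hmono : MonotoneOn (fun t => (r t ^ n)⁻¹ - C * m * t) (Set.Icc s T) := by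
    refine monotoneOn_of_hasDerivWithinAt_nonneg (convex_Icc s T)
      (fun t ht => (hder t ht).continuousAt.continuousWithinAt)
      (fun t ht => (hder t (interior_subset ht)).hasDerivWithinAt) (fun t ht => ?_)
    have ht' := interior_subset ht
    have h0 := hr t ht'
    have hpn := pow_pos h0 n
    have h1 : C / n * (m * r t ^ n) * r t ≤ -r' t := by
      have h2 : C / n * (m * r t ^ n) * r t ≤
          C / n * min (r t ^ n) (r t ^ (2 * n)) * r t := by
        gcongr
        exact hlow t ht'
      linarith [hle t ht']
    rw [sub_nonneg, le_div_iff₀ (by positivity)]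
    have h3 : C * m * (r t ^ n) ^ 2 =
        n * r t ^ (n - 1) * (C / n * (m * r t ^ n) * r t) := by
      have h4 : r t ^ n = r t ^ (n - 1) * r t := (pow_sub_one_mul hn.ne' _).symm
      have : n * r t ^ (n - 1) * (C / n * (m * r t ^ n) * r t) =
          C * m * r t ^ n * (r t ^ (n - 1) * r t) := by field_simp
      rw [this, ← h4]; ring
    rw [h3]
    have := mul_le_mul_of_nonneg_left h1 (by positivity : 0 ≤ n * r t ^ (n - 1))
    linarith
  have hfin := hmono (Set.left_mem_Icc.2 hsT) hTmem hsT
  have hpos := inv_pos.2 (pow_pos (hr s (Set.left_mem_Icc.2 hsT)) n)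
  have hPT := pow_pos hrT n
  have hkey : C * m * (T - s) ≤ (r T ^ n)⁻¹ := by
    simp only at hfin
    linarith
  have hmin : min (r T ^ n) (r T ^ (2 * n)) = m * r T ^ n := by
    rw [hm, min_mul_of_nonneg _ _ hPT.le, one_mul, two_mul, pow_add]
  rw [hmin]
  calc m * r T ^ n * (C * (T - s)) = C * m * (T - s) * r T ^ n := by ring
    _ ≤ (r T ^ n)⁻¹ * r T ^ n := by gcongr
    _ = 1 := inv_mul_cancel₀ hPT.ne'

lemma le_div_Vmin {C δ T P : ℝ} (hC : 0 < C) (hδ : 0 < δ) (hδ1 : δ ≤ 1) (hT : 0 < T)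
    (hP : 0 < P) (h : min P (P ^ 2) * (C * (δ * T)) ≤ 1) :
    P ≤ max 1 (1 / C) / δ / Vmin T := by
  set K : ℝ := max 1 (1 / C) with hK
  have hK1 : 1 ≤ K := le_max_left _ _
  have hKC : 1 ≤ K * C := by
    have : 1 / C ≤ K := le_max_right _ _
    rwa [div_le_iff₀ hC] at this
  have hV := Vmin_pos_s9 hT
  rw [div_div, le_div_iff₀ (by positivity)]
  have hmin : 0 < min P (P ^ 2) := lt_min hP (by positivity)
  have h' : min P (P ^ 2) * (δ * T) ≤ K := by
    have := mul_le_mul_of_nonneg_left h (by positivity : 0 ≤ K)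
    nlinarith [mul_nonneg (mul_pos hmin (mul_pos hδ hT)).le (sub_nonneg.2 hKC)]
  rcases le_total P (P ^ 2) with hle | hle
  · rw [min_eq_left hle] at h'
    refine le_trans ?_ h'
    gcongr
    exact min_le_left _ _
  · rw [min_eq_right hle] at h'
    have hVT : Vmin T ^ 2 ≤ T := by
      calc Vmin T ^ 2 ≤ Real.sqrt T ^ 2 := by
            gcongr
            exact min_le_right _ _
        _ = T := Real.sq_sqrt hT.le
    refine (sq_le_sq₀ (by positivity) (by positivity)).1 ?_
    calc (P * (δ * Vmin T)) ^ 2 = δ * (P ^ 2 * (δ * Vmin T ^ 2)) := by ring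
      _ ≤ 1 * (P ^ 2 * (δ * T)) := by gcongr
      _ ≤ K := by linarith
      _ ≤ K ^ 2 := by nlinarith

/-- One step of the iteration, using the damping on the time interval `[(1 - δ) T, T]` only. -/
lemma le_of_damped {C g δ X T : ℝ} {p : ℕ} (hC : 0 < C) (hg : 0 ≤ g) (hδ : 0 < δ) (hδ1 : δ < 1)
    (hT : 0 < T) (hp : 0 < p) (hX : 0 < X) {x y y' : ℝ → ℝ}
    (hx : ∀ t ∈ Set.Icc ((1 - δ) * T) T, 0 < x t)
    (hxX : ∀ t ∈ Set.Icc ((1 - δ) * T) T, x t ≤ X)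
    (hy : ∀ t ∈ Set.Icc ((1 - δ) * T) T, 0 < y t)
    (hd : ∀ t ∈ Set.Icc ((1 - δ) * T) T, HasDerivAt y (y' t) t)
    (hle : ∀ t ∈ Set.Icc ((1 - δ) * T) T, y' t ≤
      -(C / (2 * p)) * min ((y t / x t) ^ (2 * p)) ((y t / x t) ^ (4 * p)) * y t + g * y t) :
    y T ≤ X * Real.exp (g * (δ * T)) *
      ((max 1 (1 / C) / δ) ^ (1 / (2 * (p : ℝ))) * Vmin T ^ (-(1 / (2 * (p : ℝ))))) := by
  set s := (1 - δ) * T with hs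
  have hsT : s ≤ T := by nlinarith [mul_pos hδ hT]
  have hTs : T - s = δ * T := by rw [hs]; ring
  set E : ℝ → ℝ := fun t => Real.exp (-(g * (t - s))) / X with hE
  have hE0 : ∀ t, 0 < E t := fun t => by positivity
  have hEd : ∀ t, HasDerivAt E (-g * E t) t := by
    intro t
    have h := (((((hasDerivAt_id t).sub_const s).const_mul g).neg).exp).div_const X
    refine h.congr_deriv ?_
    simp only [hE, id, Pi.neg_apply]
    ring
  have hEX : ∀ t ∈ Set.Icc s T, E t ≤ 1 / X := by
    intro t ht
    simp only [hE]
    gcongr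
    rw [Real.exp_le_one_iff]
    nlinarith [mul_nonneg hg (sub_nonneg.2 ht.1)]
  have hmain := min_pow_mul_le_one (n := 2 * p) (r := fun t => y t * E t)
    (r' := fun t => y' t * E t + y t * (-g * E t)) hC (by positivity) hsT
    (fun t ht => mul_pos (hy t ht) (hE0 t)) (fun t ht => (hd t ht).mul (hEd t))
    (fun t ht => by
      have h0 := hy t ht
      have h1 := hE0 t
      have h2 : y t * E t ≤ y t / x t := by
        rw [div_eq_mul_one_div]
        gcongr
        exact (hEX t ht).trans (one_div_le_one_div_of_le (hx t ht) (hxX t ht))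
      have h3 : min ((y t * E t) ^ (2 * p)) ((y t * E t) ^ (2 * (2 * p))) ≤
          min ((y t / x t) ^ (2 * p)) ((y t / x t) ^ (4 * p)) := by
        rw [show 2 * (2 * p) = 4 * p by ring]
        apply min_le_min <;> gcongr
      have h4 := mul_le_mul_of_nonneg_right (hle t ht) h1.le
      have h5 : C / (2 * p) * min ((y t * E t) ^ (2 * p)) ((y t * E t) ^ (2 * (2 * p))) *
            (y t * E t) ≤
          C / (2 * p) * min ((y t / x t) ^ (2 * p)) ((y t / x t) ^ (4 * p)) * (y t * E t) := by
        gcongr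
      push_cast
      linarith)
  have hr : 0 < y T * E T := mul_pos (hy T (Set.right_mem_Icc.2 hsT)) (hE0 T)
  rw [mul_comm 2 (2 * p), pow_mul _ (2 * p) 2, hTs] at hmain
  have hP := le_div_Vmin hC hδ hδ1.le hT (pow_pos hr (2 * p)) hmain
  have hV := Vmin_pos_s9 hT
  have hK : 0 < max 1 (1 / C) / δ := by positivity
  have hroot : y T * E T ≤
      (max 1 (1 / C) / δ) ^ (1 / (2 * (p : ℝ))) * Vmin T ^ (-(1 / (2 * (p : ℝ)))) := by
    have h := Real.rpow_le_rpow (by positivity) hP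
      (by positivity : 0 ≤ 1 / (2 * (p : ℝ)))
    rw [Real.div_rpow hK.le hV.le, ← Real.rpow_natCast, ← Real.rpow_mul hr.le] at h
    rw [Real.rpow_neg hV.le, ← div_eq_mul_inv]
    refine le_trans (le_of_eq ?_) h
    rw [show ((2 * p : ℕ) : ℝ) * (1 / (2 * (p : ℝ))) = 1 by
      push_cast
      field_simp, Real.rpow_one]
  have hyT : y T = X * Real.exp (g * (δ * T)) * (y T * E T) := by
    simp only [hE, hTs, Real.exp_neg]
    field_simp
  rw [hyT]
  gcongr

/-- The cost of one iteration step with `δ = η / (2 p²)`, `p = 2 ^ k`. -/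
lemma step_constant_le {K η θ : ℝ} (hK : 1 ≤ K) (hη : 0 < η) (hη1 : η ≤ 1) (hθ : θ ≤ 1)
    {k : ℕ} :
    (1 - η / (2 * (2 ^ k) ^ 2)) ^ (-θ) * (K / (η / (2 * (2 ^ k) ^ 2))) ^ (1 / (2 * (2 : ℝ) ^ k)) ≤
      Real.exp ((k + (1 + Real.log (2 * K / η) / 2)) / 2 ^ k) := by
  set p : ℝ := 2 ^ k with hp
  have hp1 : 1 ≤ p := one_le_pow₀ (by norm_num)
  have hp0 : 0 < p := by linarith
  set δ := η / (2 * p ^ 2) with hδdef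
  have hδ0 : 0 < δ := by positivity
  have hδp : 2 * δ ≤ 1 / p := by
    rw [hδdef, le_div_iff₀ hp0, mul_comm 2 (η / _), mul_assoc, div_mul_eq_mul_div,
      div_le_iff₀ (by positivity)]
    nlinarith
  have hδ2 : δ ≤ 1 / 2 := by
    have : 1 / p ≤ 1 := (div_le_one hp0).2 hp1
    linarith
  have h1δ : 0 < 1 - δ := by linarith
  have h1 : (1 - δ) ^ (-θ) ≤ Real.exp (1 / p) := by
    calc (1 - δ) ^ (-θ) ≤ (1 - δ) ^ (-1 : ℝ) :=
          Real.rpow_le_rpow_of_exponent_ge h1δ (by linarith) (by linarith)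
      _ = (1 - δ)⁻¹ := Real.rpow_neg_one _
      _ ≤ 2 * δ + 1 := by
          rw [inv_le_iff_one_le_mul₀ h1δ]
          nlinarith
      _ ≤ Real.exp (2 * δ) := Real.add_one_le_exp _
      _ ≤ Real.exp (1 / p) := Real.exp_le_exp.2 hδp
  have hL : 0 < 2 * K / η := by positivity
  have h2 : (K / δ) ^ (1 / (2 * p)) ≤ Real.exp ((Real.log (2 * K / η) / 2 + k) / p) := by
    rw [show K / δ = 2 * K / η * p ^ 2 by rw [hδdef]; field_simp,
      Real.rpow_def_of_pos (by positivity), Real.exp_le_exp,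
      Real.log_mul hL.ne' (by positivity), Real.log_pow, hp, Real.log_pow, ← hp]
    have hlog : Real.log 2 ≤ 1 := by linarith [Real.log_two_lt_d9]
    have : (k : ℝ) * Real.log 2 ≤ k := mul_le_of_le_one_right (by positivity) hlog
    calc (Real.log (2 * K / η) + (2 : ℕ) * (k * Real.log 2)) * (1 / (2 * p))
        = (Real.log (2 * K / η) / 2 + k * Real.log 2) / p := by
          push_cast
          field_simp
      _ ≤ _ := by gcongr
  calc _ ≤ Real.exp (1 / p) * Real.exp ((Real.log (2 * K / η) / 2 + k) / p) := by gcongr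
    _ = _ := by
      rw [← Real.exp_add]
      congr 1
      ring

lemma le_exp_mul_of_deriv_le {y : ℝ → ℝ} {g : ℝ}
    (hd : ∀ t, 0 ≤ t → DifferentiableAt ℝ y t) (hle : ∀ t, 0 < t → deriv y t ≤ g * y t)
    {t : ℝ} (ht : 0 ≤ t) : y t ≤ Real.exp (g * t) * y 0 := by
  have hder : ∀ t, 0 ≤ t → HasDerivAt (fun t => Real.exp (-(g * t)) * y t)
      (Real.exp (-(g * t)) * (deriv y t - g * y t)) t := by
    intro t ht
    have h := ((((hasDerivAt_id t).const_mul g).neg).exp).mul (hd t ht).hasDerivAt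
    refine h.congr_deriv ?_
    simp only [id, Pi.neg_apply]
    ring
  have hanti : AntitoneOn (fun t => Real.exp (-(g * t)) * y t) (Set.Ici 0) := by
    refine antitoneOn_of_hasDerivWithinAt_nonpos (convex_Ici 0)
      (fun t ht => (hder t ht).continuousAt.continuousWithinAt)
      (fun t ht => (hder t (interior_subset ht)).hasDerivWithinAt) (fun t ht => ?_)
    rw [interior_Ici] at ht
    exact mul_nonpos_of_nonneg_of_nonpos (Real.exp_pos _).le (by linarith [hle t ht])
  have h := hanti Set.self_mem_Ici ht ht
  simp only [mul_zero, neg_zero, Real.exp_zero, one_mul, Real.exp_neg] at h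
  rwa [inv_mul_le_iff₀ (Real.exp_pos _)] at h

/-- Iteration lemma: if the family `w_p`, `p ∈ {1} ∪ {2^k : k ≥ 1}` (indexed here by
`p = 2^k`, `k ∈ ℕ`), consists of positive differentiable functions satisfying
`w_{2p}' ≤ -(C/(2p)) min{(w_{2p}/w_p)^{2p}, (w_{2p}/w_p)^{4p}} w_{2p} + α²(1+(p/2)M²) w_{2p}`,
then for every `ε > 0` there is `C_ε > 0`, depending only on `ε` and `C`, with
`w_p(t) ≤ C_ε e^{(1+ε)α²(1+M²)t} V(t)^{-(p-2)/(2p)} w₂(0)` for all `t > 0`, `p ∈ S`. -/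
theorem iteration_lemma :
    ∀ C > (0:ℝ), ∀ ε > (0:ℝ), ∃ Cε > (0:ℝ),
      ∀ (M α : ℝ), 0 ≤ M →
      ∀ w : ℕ → ℝ → ℝ,
      (∀ k : ℕ, ∀ t : ℝ, 0 ≤ t → 0 < w (2 ^ k) t) →
      (∀ k : ℕ, ∀ t : ℝ, 0 ≤ t → DifferentiableAt ℝ (w (2 ^ k)) t) →
      (∀ k : ℕ, ∀ t : ℝ, 0 < t →
        deriv (w (2 ^ (k + 1))) t ≤
          -(C / (2 * ((2:ℝ) ^ k))) *
              min ((w (2 ^ (k + 1)) t / w (2 ^ k) t) ^ (2 * 2 ^ k))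
                ((w (2 ^ (k + 1)) t / w (2 ^ k) t) ^ (4 * 2 ^ k))
              * w (2 ^ (k + 1)) t
            + α ^ 2 * (1 + ((2:ℝ) ^ k / 2) * M ^ 2) * w (2 ^ (k + 1)) t) →
      ∀ k : ℕ, 1 ≤ k → ∀ t : ℝ, 0 < t →
        w (2 ^ k) t ≤ Cε * Real.exp ((1 + ε) * α ^ 2 * (1 + M ^ 2) * t)
          * Vmin t ^ (-(((2:ℝ) ^ k - 2) / (2 * (2:ℝ) ^ k)))
          * w 2 0 := by
  intro C hC ε hε
  set K : ℝ := max 1 (1 / C) with hK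
  set η : ℝ := min ε 1 with hη
  have hK1 : 1 ≤ K := le_max_left _ _
  have hη0 : 0 < η := lt_min hε one_pos
  have hη1 : η ≤ 1 := min_le_right _ _
  have hηε : η ≤ ε := min_le_left _ _
  set D : ℝ := 1 + Real.log (2 * K / η) / 2 with hD
  have hD0 : 0 ≤ D := by
    have : 0 ≤ Real.log (2 * K / η) := by
      apply Real.log_nonneg
      rw [le_div_iff₀ hη0]
      linarith
    positivity
  refine ⟨Real.exp (D + 2), Real.exp_pos _, ?_⟩
  intro M α hM w hpos hdiff hineq
  have hw0 : 0 < w 2 0 := by simpa using hpos 1 0 le_rfl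
  set G : ℝ := α ^ 2 * (1 + M ^ 2) with hG
  have hG0 : 0 ≤ G := by positivity
  have key : ∀ k : ℕ, 1 ≤ k → ∀ t : ℝ, 0 < t →
      w (2 ^ k) t ≤ Real.exp (D + 2 - 2 * (k + D + 1) / 2 ^ k) *
        Real.exp ((1 + η * (1 - 1 / 2 ^ k)) * G * t) *
        Vmin t ^ (-(((2 : ℝ) ^ k - 2) / (2 * (2 : ℝ) ^ k))) * w 2 0 := by
    intro k hk
    induction k, hk using Nat.le_induction with
    | base =>
      intro t ht
      have h := le_exp_mul_of_deriv_le (y := w (2 ^ 1)) (g := α ^ 2 * (1 + 1 / 2 * M ^ 2))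
        (hdiff 1) (fun t ht => by
          refine (hineq 0 t ht).trans ?_
          have h1 := hpos 1 t ht.le
          have h0 := hpos 0 t ht.le
          have : 0 ≤ C / (2 * (2 : ℝ) ^ 0) *
              min ((w (2 ^ (0 + 1)) t / w (2 ^ 0) t) ^ (2 * 2 ^ 0))
                ((w (2 ^ (0 + 1)) t / w (2 ^ 0) t) ^ (4 * 2 ^ 0)) * w (2 ^ (0 + 1)) t := by
            rw [zero_add]
            positivity
          rw [zero_add, pow_zero] at *
          linarith) ht.le
      rw [pow_one] at h ⊢
      refine h.trans ?_
      have hconst : D + 2 - 2 * (((1 : ℕ) : ℝ) + D + 1) / 2 ^ 1 = 0 := by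
        push_cast
        ring
      rw [hconst, Real.exp_zero, one_mul]
      have hV : Vmin t ^ (-(((2 : ℝ) ^ 1 - 2) / (2 * (2 : ℝ) ^ 1))) = 1 := by norm_num
      rw [hV, mul_one]
      gcongr ?_ * _
      rw [Real.exp_le_exp]
      refine mul_le_mul_of_nonneg_right ?_ ht.le
      have : α ^ 2 * (1 + 1 / 2 * M ^ 2) ≤ G := by
        rw [hG]
        gcongr
        nlinarith [sq_nonneg M]
      nlinarith [mul_nonneg hη0.le hG0]
    | succ k hk ih =>
      intro T hT
      set p : ℝ := 2 ^ k with hp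
      have hp2 : 2 ≤ p := by
        calc (2 : ℝ) = 2 ^ 1 := by norm_num
          _ ≤ 2 ^ k := pow_le_pow_right₀ (by norm_num) hk
      have hp0 : 0 < p := by linarith
      set δ : ℝ := η / (2 * p ^ 2) with hδ
      have hδ0 : 0 < δ := by positivity
      have hδ1 : δ < 1 := by
        rw [hδ, div_lt_one (by positivity)]
        nlinarith
      have h1δ : 0 < 1 - δ := by linarith
      set θ : ℝ := (p - 2) / (2 * p) with hθ
      have hθ0 : 0 ≤ θ := div_nonneg (by linarith) (by positivity)
      have hθ1 : θ ≤ 1 := by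
        rw [hθ, div_le_one (by positivity)]
        linarith
      have hV := Vmin_pos_s9 hT
      set lam : ℝ := (1 + η * (1 - 1 / p)) * G with hlam
      have hlam0 : 0 ≤ lam := by
        have : 1 / p ≤ 1 := (div_le_one hp0).2 (by linarith)
        have : 0 ≤ 1 - 1 / p := by linarith
        positivity
      set A : ℝ := Real.exp (D + 2 - 2 * (k + D + 1) / p) with hA
      set X : ℝ := A * Real.exp (lam * T) * ((1 - δ) * Vmin T) ^ (-θ) * w 2 0 with hX
      have hs0 : 0 < (1 - δ) * T := by positivity
      have hcast : ((2 ^ k : ℕ) : ℝ) = p := by rw [hp]; push_cast; rfl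
      have hg0 : 0 ≤ α ^ 2 * (1 + p / 2 * M ^ 2) := by positivity
      have hstep := le_of_damped (p := 2 ^ k) (X := X) (x := w (2 ^ k)) (y := w (2 ^ (k + 1)))
        (y' := deriv (w (2 ^ (k + 1)))) hC hg0 hδ0 hδ1 hT (by positivity) (by positivity)
        (fun t ht => hpos k t (hs0.le.trans ht.1))
        (fun t ht => by
          have ht0 : 0 < t := hs0.trans_le ht.1
          refine (ih t ht0).trans ?_
          rw [hX]
          have hVt := Vmin_pos_s9 ht0
          gcongr A * Real.exp ?_ * ?_ * _
          · exact mul_le_mul_of_nonneg_left ht.2 hlam0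
          · exact Real.rpow_le_rpow_of_nonpos (by positivity)
              (mul_Vmin_le h1δ.le (by linarith) hT.le ht.1) (by linarith))
        (fun t ht => hpos (k + 1) t (hs0.le.trans ht.1))
        (fun t ht => (hdiff (k + 1) t (hs0.le.trans ht.1)).hasDerivAt)
        (fun t ht => by
          rw [hcast]
          exact hineq k t (hs0.trans_le ht.1))
      rw [hcast] at hstep
      have hcost := step_constant_le (θ := θ) (k := k) hK1 hη0 hη1 hθ1
      rw [← hp, ← hδ, ← hD] at hcost
      have hgrow : Real.exp (lam * T) * Real.exp (α ^ 2 * (1 + p / 2 * M ^ 2) * (δ * T)) ≤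
          Real.exp ((1 + η * (1 - 1 / 2 ^ (k + 1))) * G * T) := by
        rw [← Real.exp_add, Real.exp_le_exp]
        have h1 : α ^ 2 * (1 + p / 2 * M ^ 2) ≤ p * G := by
          have : 1 + p / 2 * M ^ 2 ≤ p * (1 + M ^ 2) := by nlinarith [sq_nonneg M]
          calc _ ≤ α ^ 2 * (p * (1 + M ^ 2)) := by gcongr
            _ = p * G := by rw [hG]; ring
        calc _ ≤ lam * T + p * G * (δ * T) := by gcongr
          _ = _ := by
            rw [hlam, hδ, pow_succ 2 k, ← hp]
            field_simp
            ring
      have hVexp : Vmin T ^ (-θ) * Vmin T ^ (-(1 / (2 * p))) =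
          Vmin T ^ (-(((2 : ℝ) ^ (k + 1) - 2) / (2 * (2 : ℝ) ^ (k + 1)))) := by
        rw [← Real.rpow_add hV]
        congr 1
        rw [hθ, pow_succ, ← hp]
        field_simp
        ring
      have hAexp : A * Real.exp ((k + D) / p) =
          Real.exp (D + 2 - 2 * (((k + 1 : ℕ) : ℝ) + D + 1) / 2 ^ (k + 1)) := by
        rw [hA, ← Real.exp_add]
        congr 1
        rw [pow_succ, ← hp]
        push_cast
        field_simp
        ring
      rw [← hAexp, ← hVexp]
      refine hstep.trans ?_
      rw [hX, Real.mul_rpow h1δ.le hV.le]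
      calc _ = A * ((1 - δ) ^ (-θ) * (K / δ) ^ (1 / (2 * p))) *
            (Real.exp (lam * T) * Real.exp (α ^ 2 * (1 + p / 2 * M ^ 2) * (δ * T))) *
            (Vmin T ^ (-θ) * Vmin T ^ (-(1 / (2 * p)))) * w 2 0 := by ring
        _ ≤ _ := by gcongr
  intro k hk t ht
  refine (key k hk t ht).trans ?_
  have hV := Vmin_pos_s9 ht
  gcongr ?_ * ?_ * _ * _
  · rw [Real.exp_le_exp, sub_le_self_iff]
    positivity
  · rw [Real.exp_le_exp, mul_assoc (1 + ε), ← hG]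
    have : 0 < 1 / (2 : ℝ) ^ k := by positivity
    gcongr
    nlinarith


end NS
end
end

section
/- Let c > 0 and let N : [0,∞) → (0,∞) be differentiable with N'(t) ≤ −c · min(N(t)², N(t)³) for all t > 0. Then for every t > 0: if ct ≤ 1 then N(t) ≤ 1/(ct), and if ct > 1 then N(t) ≤ 1/√(2ct − 1). -/
noncomputable section

namespace NS

/-- Integrated form of the differential inequality `N' ≤ -c N ^ (p + 1)`. -/
lemma inv_pow_sub_inv_pow_ge (p : ℕ) {c a b : ℝ} {N : ℝ → ℝ} (hab : a ≤ b)
    (hpos : ∀ t ∈ Set.Icc a b, 0 < N t)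
    (hdiff : ∀ t ∈ Set.Icc a b, DifferentiableAt ℝ N t)
    (hineq : ∀ t ∈ Set.Ioo a b, deriv N t ≤ -c * N t ^ (p + 1)) :
    p * c * (b - a) ≤ (N b ^ p)⁻¹ - (N a ^ p)⁻¹ := by
  have hderiv : ∀ t ∈ Set.Icc a b, HasDerivAt (fun s => (N s ^ p)⁻¹)
      (-(p * N t ^ (p - 1) * deriv N t) / (N t ^ p) ^ 2) t := fun t ht =>
    ((hdiff t ht).hasDerivAt.pow p).inv (pow_pos (hpos t ht) p).ne'
  refine (convex_Icc a b).mul_sub_le_image_sub_of_le_deriv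
    (fun t ht => (hderiv t ht).continuousAt.continuousWithinAt)
    (fun t ht => (hderiv t (interior_subset ht)).differentiableAt.differentiableWithinAt)
    ?_ a (Set.left_mem_Icc.2 hab) b (Set.right_mem_Icc.2 hab) hab
  intro t ht
  rw [(hderiv t (interior_subset ht)).deriv]
  have hN := hpos t (interior_subset ht)
  rw [interior_Icc] at ht
  have h := hineq t ht
  rw [le_div_iff₀ (by positivity)]
  rcases p with _ | q
  · simp
  · have h2 : 0 ≤ ((q + 1 : ℕ) : ℝ) * N t ^ q := by positivity
    have h3 := mul_le_mul_of_nonneg_left h h2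
    simp only [Nat.add_sub_cancel]
    calc _ = -(((q + 1 : ℕ) : ℝ) * N t ^ q * (-c * N t ^ (q + 1 + 1))) := by ring
      _ ≤ _ := neg_le_neg h3

/-- If `N : [0,∞) → (0,∞)` is differentiable and `N' ≤ -c min(N², N³)`, then
`N(t) ≤ 1/(ct)` when `ct ≤ 1`, and `N(t) ≤ 1/√(2ct - 1)` when `ct > 1`. -/
theorem ode_decay (c : ℝ) (hc : 0 < c) (N : ℝ → ℝ)
    (hpos : ∀ t : ℝ, 0 ≤ t → 0 < N t)
    (hdiff : ∀ t : ℝ, 0 ≤ t → DifferentiableAt ℝ N t)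
    (hineq : ∀ t : ℝ, 0 < t → deriv N t ≤ -c * min (N t ^ 2) (N t ^ 3)) :
    ∀ t : ℝ, 0 < t →
      (c * t ≤ 1 → N t ≤ 1 / (c * t)) ∧
      (1 < c * t → N t ≤ 1 / Real.sqrt (2 * c * t - 1)) := by
  have hanti : AntitoneOn N (Set.Ici 0) := by
    refine antitoneOn_of_deriv_nonpos (convex_Ici 0)
      (fun t ht => (hdiff t ht).continuousAt.continuousWithinAt)
      (fun t ht => (hdiff t (interior_subset ht)).differentiableWithinAt) fun t ht => ?_
    rw [interior_Ici] at ht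
    have hN := hpos t (le_of_lt ht)
    have : 0 ≤ c * min (N t ^ 2) (N t ^ 3) := by positivity
    linarith [hineq t ht]
  have hlarge : ∀ t, 0 ≤ t → 1 ≤ N t → c * t ≤ (N t)⁻¹ := by
    intro t ht h1
    have h := inv_pow_sub_inv_pow_ge 1 (c := c) ht (fun s hs => hpos s hs.1)
      (fun s hs => hdiff s hs.1) fun s hs => by
        have hs1 : 1 ≤ N s := h1.trans (hanti hs.1.le ht hs.2.le)
        have := hineq s hs.1
        rwa [min_eq_left (pow_le_pow_right₀ hs1 (by norm_num))] at this
    have h0 := inv_pos.2 (hpos 0 le_rfl)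
    norm_num at h
    linarith
  have hsmall : ∀ a t, 0 ≤ a → a ≤ t → N a ≤ 1 → 1 + 2 * c * (t - a) ≤ (N t ^ 2)⁻¹ := by
    intro a t ha hat h1
    have h := inv_pow_sub_inv_pow_ge 2 (c := c) hat (fun s hs => hpos s (ha.trans hs.1))
      (fun s hs => hdiff s (ha.trans hs.1)) fun s hs => by
        have hs0 : 0 < s := ha.trans_lt hs.1
        have hs1 : N s ≤ 1 := (hanti ha hs0.le hs.1.le).trans h1
        have := hineq s hs0
        rwa [min_eq_right (pow_le_pow_of_le_one (hpos s hs0.le).le hs1 (by norm_num))] at this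
    have hNa := hpos a ha
    have h0 : 1 ≤ (N a ^ 2)⁻¹ := (one_le_inv₀ (by positivity)).2 (pow_le_one₀ hNa.le h1)
    push_cast at h
    linarith
  intro t ht
  have hN := hpos t ht.le
  have hct : 0 < c * t := mul_pos hc ht
  refine ⟨fun h => ?_, fun h => ?_⟩
  · rcases le_total 1 (N t) with h1 | h1
    · rw [one_div]
      exact (le_inv_comm₀ hct hN).1 (hlarge t ht.le h1)
    · exact h1.trans ((one_le_div hct).2 h)
  · have h1 : N t ≤ 1 := by
      by_contra! h1
      exact absurd ((hlarge t ht.le h1.le).trans (inv_le_one_of_one_le₀ h1.le)) (not_le.2 h)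
    obtain ⟨a, ha, hat, hNa, hca⟩ : ∃ a, 0 ≤ a ∧ a ≤ t ∧ N a ≤ 1 ∧ c * a ≤ 1 := by
      rcases le_total (N 0) 1 with h0 | h0
      · exact ⟨0, le_rfl, ht.le, h0, by simp⟩
      · obtain ⟨a, ha, hNa⟩ := intermediate_value_Icc' ht.le
          (fun s hs => (hdiff s hs.1).continuousAt.continuousWithinAt) ⟨h1, h0⟩
        refine ⟨a, ha.1, ha.2, hNa.le, ?_⟩
        simpa [hNa] using hlarge a ha.1 hNa.ge
    have hs := hsmall a t ha hat hNa
    have hd : 0 < 2 * c * t - 1 := by linarith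
    rw [one_div, le_inv_comm₀ hN (Real.sqrt_pos.2 hd)]
    refine Real.sqrt_le_iff.2 ⟨by positivity, ?_⟩
    rw [inv_pow]
    linarith

end NS
end
end
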